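/- arXiv:2302.12754 — 2 statements merged into one kernel-verified Lean document; each statement's English description precedes it below -/
import Mathlib

section
/- Let X and Y be complete metric spaces and T a metric space. For every t ∈ T let μ_t ∈ P_r(X) and ν_t ∈ P_r(Y) be such that the mappings t ↦ μ_t and t ↦ ν_t are continuous in the weak topology. Let h : X × Y × T → [0,∞) be continuous, and suppose that for every t there exist nonnegative Borel functions a_t ∈ L¹(μ_t) and b_t ∈ L¹(ν_t) such that h(x,y,t) ≤ a_t(x) + b_t(y) and lim_{R→+∞} sup_t ( ∫_{{a_t ≥ R}} a_t dμ_t + ∫_{{b_t ≥ R}} b_t dν_t ) = 0. Then for every fixed ε > 0 one can select ε-optimal measures σ_t^ε ∈ Π(μ_t, ν_t) for the cost functions h_t = h(·,·,t) such that the mapping t ↦ σ_t^ε is continuous in the weak topology. -/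
open MeasureTheory Filter Topology

noncomputable section

/-- `σ` is a coupling of `μ` and `ν`, i.e. an element of `Π(μ, ν)`: a measure on the
product whose projections onto the factors are `μ` and `ν`. -/
def IsCoupling {X Y : Type*} [MeasurableSpace X] [MeasurableSpace Y]
    (σ : Measure (X × Y)) (μ : Measure X) (ν : Measure Y) : Prop :=
  σ.map Prod.fst = μ ∧ σ.map Prod.snd = ν

/-- The Kantorovich optimal transportation cost
`K_h(μ, ν) = inf {∫ h dσ : σ ∈ Π(μ, ν)}` (for a nonnegative cost `h`). -/
def kantorovichCost {X Y : Type*} [MeasurableSpace X] [MeasurableSpace Y]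
    (h : X → Y → ℝ) (μ : Measure X) (ν : Measure Y) : ENNReal :=
  ⨅ (σ : Measure (X × Y)) (_ : IsCoupling σ μ ν), ∫⁻ p, ENNReal.ofReal (h p.1 p.2) ∂σ

/-- A family of measures `t ↦ μ t` is continuous in the weak topology generated by
integration against bounded continuous functions. -/
def WeaklyContinuousFamily {T X : Type*} [TopologicalSpace T] [TopologicalSpace X]
    [MeasurableSpace X] (μ : T → Measure X) : Prop :=
  ∀ f : BoundedContinuousFunction X ℝ, Continuous fun t => ∫ x, f x ∂(μ t)


/-- A finite continuous partition subordinate to small balls around points of a compact set. -/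
theorem aux_partition {X : Type*} [MetricSpace X] (K : Set X) (hK : IsCompact K)
    (hne : K.Nonempty) (r : ℝ) (hr : 0 < r) :
    ∃ (s : Finset X) (φ : Option s → X → ℝ), (∀ x ∈ s, x ∈ K) ∧ (∀ i, Continuous (φ i)) ∧
      (∀ i x, 0 ≤ φ i x) ∧ (∀ x, ∑ i, φ i x = 1) ∧ (∀ x ∈ K, φ none x = 0) ∧
      (∀ (i : s) x, φ (some i) x ≠ 0 → dist x i < r) := by
  obtain ⟨t, htK, htf, hcov⟩ := hK.finite_cover_balls hr
  lift t to Finset X using htf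
  let θ : Option t → X → ℝ := fun i x => match i with
    | none => Metric.infDist x K
    | some i => max 0 (r - dist x i)
  have hθc : ∀ i, Continuous (θ i) := by
    rintro (_ | i)
    · exact Metric.continuous_infDist_pt K
    · exact continuous_const.max (continuous_const.sub (continuous_id.dist continuous_const))
  have hθ0 : ∀ i x, 0 ≤ θ i x := by
    rintro (_ | i) x
    · exact Metric.infDist_nonneg
    · exact le_max_left _ _
  have hS : ∀ x, 0 < ∑ i, θ i x := by
    intro x
    have key : ∃ i, 0 < θ i x := by
      by_cases hx : x ∈ K
      · have := hcov hx
        simp only [Set.mem_iUnion] at this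
        obtain ⟨y, hy, hxy⟩ := this
        refine ⟨some ⟨y, hy⟩, ?_⟩
        exact lt_max_of_lt_right (sub_pos.2 hxy)
      · exact ⟨none, (hK.isClosed.notMem_iff_infDist_pos hne).1 hx⟩
    obtain ⟨i, hi⟩ := key
    exact Finset.sum_pos' (fun j _ => hθ0 j x) ⟨i, Finset.mem_univ _, hi⟩
  refine ⟨t, fun i x => θ i x / ∑ j, θ j x, fun x hx => htK hx, ?_, ?_, ?_, ?_, ?_⟩
  · intro i
    exact (hθc i).div (continuous_finsetSum _ fun j _ => hθc j) (fun x => (hS x).ne')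
  · intro i x
    exact div_nonneg (hθ0 i x) (hS x).le
  · intro x
    rw [← Finset.sum_div, div_self (hS x).ne']
  · intro x hx
    have : θ none x = 0 := Metric.infDist_zero_of_mem hx
    simp [this]
  · intro i x hx
    by_contra hcon
    apply hx
    have : θ (some i) x = 0 := max_eq_left (by linarith)
    simp [this]

theorem aux_sep {X : Type*} [MetricSpace X] [MeasurableSpace X] [BorelSpace X]
    (μ : Measure X) [IsProbabilityMeasure μ] [μ.InnerRegular] :
    ∃ e : ℕ → X, ∀ᵐ x ∂μ, x ∈ closure (Set.range e) := by
  have h1 : ∀ n : ℕ, ∃ K ⊆ (Set.univ : Set X), IsCompact K ∧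
      μ (Set.univ \ K) < (1 / ((n : ENNReal) + 1)) := fun n =>
    MeasurableSet.univ.exists_isCompact_sdiff_lt (measure_ne_top μ _) (by simp)
  choose K _ hK hKμ using h1
  have hsep : TopologicalSpace.IsSeparable (⋃ n, K n) :=
    TopologicalSpace.IsSeparable.iUnion fun n => (hK n).isSeparable
  obtain ⟨c, hc, hsub⟩ := hsep
  have : Nonempty X := nonempty_of_isProbabilityMeasure μ
  obtain ⟨x0⟩ := this
  have hc' : (insert x0 c).Countable := hc.insert x0
  obtain ⟨e, he⟩ := hc'.exists_eq_range (Set.insert_nonempty _ _)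
  refine ⟨e, ?_⟩
  rw [← he]
  have : μ ((closure (insert x0 c))ᶜ) = 0 := by
    by_contra hne
    obtain ⟨n, hn⟩ := ENNReal.exists_inv_nat_lt hne
    have h2 : μ ((closure (insert x0 c))ᶜ) ≤ μ (Set.univ \ K n) := by
      apply measure_mono
      intro x hx
      refine ⟨trivial, fun hxK => hx ?_⟩
      exact closure_mono (Set.subset_insert _ _) (hsub (Set.mem_iUnion.2 ⟨n, hxK⟩))
    have h3 : (1 / ((n : ENNReal) + 1)) ≤ (n : ENNReal)⁻¹ := by
      rw [one_div]
      exact ENNReal.inv_le_inv.2 le_self_add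
    exact absurd (hn.trans_le h2) (not_lt.2 ((hKμ n).le.trans h3))
  exact this

theorem aux_aemeas {X Y : Type*} [MetricSpace X] [MeasurableSpace X] [BorelSpace X]
    [MetricSpace Y] [MeasurableSpace Y] [BorelSpace Y]
    (μ : Measure X) (ν : Measure Y) [IsProbabilityMeasure μ] [μ.InnerRegular]
    [IsProbabilityMeasure ν] [ν.InnerRegular] (σ : Measure (X × Y)) (hσ : IsCoupling σ μ ν)
    (f : X × Y → ℝ) (hf : Continuous f) : AEMeasurable f σ := by
  obtain ⟨e, he⟩ := aux_sep μ
  obtain ⟨d, hd⟩ := aux_sep ν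
  rw [← hσ.1] at he
  rw [← hσ.2] at hd
  have he' := ae_of_ae_map measurable_fst.aemeasurable he
  have hd' := ae_of_ae_map measurable_snd.aemeasurable hd
  refine aemeasurable_of_tendsto_metrizable_ae atTop
    (f := fun n p => f (SimpleFunc.nearestPt e n p.1, SimpleFunc.nearestPt d n p.2)) ?_ ?_
  · intro n
    have : Measurable (((SimpleFunc.pair ((SimpleFunc.nearestPt e n).comp (Prod.fst : X × Y → X)
      measurable_fst) ((SimpleFunc.nearestPt d n).comp (Prod.snd : X × Y → Y)
      measurable_snd)).map f : SimpleFunc (X × Y) ℝ)) := SimpleFunc.measurable _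
    exact this.aemeasurable
  · filter_upwards [he', hd'] with p h1 h2
    exact (hf.tendsto p).comp
      ((SimpleFunc.tendsto_nearestPt h1).prodMk_nhds (SimpleFunc.tendsto_nearestPt h2))

theorem aux_integrable {X Y : Type*} [MetricSpace X] [MeasurableSpace X] [BorelSpace X]
    [MetricSpace Y] [MeasurableSpace Y] [BorelSpace Y]
    (μ : Measure X) (ν : Measure Y) [IsProbabilityMeasure μ] [μ.InnerRegular]
    [IsProbabilityMeasure ν] [ν.InnerRegular] (σ : Measure (X × Y)) (hσ : IsCoupling σ μ ν)
    (f : X × Y → ℝ) (hf : Continuous f) (C : ℝ) (hC : ∀ p, |f p| ≤ C) : Integrable f σ := by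
  have hfin : IsFiniteMeasure σ := by
    refine ⟨?_⟩
    have : σ Set.univ = μ Set.univ := by
      rw [← hσ.1, Measure.map_apply measurable_fst MeasurableSet.univ, Set.preimage_univ]
    rw [this]
    exact measure_lt_top _ _
  exact Integrable.of_bound (aux_aemeas μ ν σ hσ f hf).aestronglyMeasurable C
    (Eventually.of_forall fun p => hC p)

theorem aux_prod_coupling {X Y : Type*} [MeasurableSpace X] [MeasurableSpace Y]
    (μ : Measure X) (ν : Measure Y) [IsProbabilityMeasure μ] [IsProbabilityMeasure ν] :
    IsCoupling (μ.prod ν) μ ν := by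
  constructor <;> simp

/-- finite dimensional transfer -/
theorem aux_fd {T I J : Type*} [TopologicalSpace T] [Fintype I] [Fintype J]
    (w : I → J → ℝ) (p : I → ℝ) (q : J → ℝ) (p' : T → I → ℝ) (q' : T → J → ℝ)
    (hw : ∀ i j, 0 ≤ w i j) (hp : ∀ i, ∑ j, w i j = p i) (hq : ∀ j, ∑ i, w i j = q j)
    (hp1 : ∑ i, p i = 1)
    (hp'0 : ∀ t i, 0 ≤ p' t i) (hq'0 : ∀ t j, 0 ≤ q' t j)
    (hp'1 : ∀ t, ∑ i, p' t i = 1) (hq'1 : ∀ t, ∑ j, q' t j = 1)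
    (hp'c : ∀ i, Continuous fun t => p' t i) (hq'c : ∀ j, Continuous fun t => q' t j)
    (κ : ℝ) (hκ : 0 < κ) (hκ1 : κ ≤ 1) :
    ∃ β : T → I → J → ℝ, (∀ i j, Continuous fun t => β t i j) ∧ (∀ t i j, 0 ≤ β t i j) ∧
      (∀ t i, ∑ j, β t i j * q' t j = 1) ∧ (∀ t j, ∑ i, β t i j * p' t i = 1) ∧
      (∀ t (hi : I → J → ℝ) (M : ℝ), (∀ i j, 0 ≤ hi i j) → (∀ i j, hi i j ≤ M) →
        ∑ i, ∑ j, hi i j * (β t i j * (p' t i * q' t j)) ≤ ∑ i, ∑ j, hi i j * w i j +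
          M * (κ + ∑ i, |p i - p' t i| + ∑ j, |q j - q' t j|)) := by
  obtain ⟨c, hc⟩ : ∃ c, c = 1 - κ := ⟨_, rfl⟩
  have hc0 : 0 ≤ c := by linarith
  have hc1 : c < 1 := by linarith
  have hp0 : ∀ i, 0 ≤ p i := fun i => by rw [← hp]; exact Finset.sum_nonneg fun j _ => hw i j
  have hq0 : ∀ j, 0 ≤ q j := fun i => by rw [← hq]; exact Finset.sum_nonneg fun j _ => hw _ _
  have hwp : ∀ i j, w i j ≤ p i := fun i j => by
    rw [← hp]; exact Finset.single_le_sum (fun j _ => hw i j) (Finset.mem_univ j)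
  have hwq : ∀ i j, w i j ≤ q j := fun i j => by
    rw [← hq]; exact Finset.single_le_sum (f := fun i => w i j) (fun i _ => hw i j)
      (Finset.mem_univ i)
  let P : T → I → ℝ := fun t i => p' t i / max (p i) (p' t i)
  let Q : T → J → ℝ := fun t j => q' t j / max (q j) (q' t j)
  have hP0 : ∀ t i, 0 ≤ P t i := fun t i => div_nonneg (hp'0 t i) (le_max_of_le_left (hp0 i))
  have hQ0 : ∀ t i, 0 ≤ Q t i := fun t i => div_nonneg (hq'0 t i) (le_max_of_le_left (hq0 i))
  have hP1 : ∀ t i, P t i ≤ 1 := fun t i =>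
    div_le_one_of_le₀ (le_max_right _ _) (le_max_of_le_left (hp0 i))
  have hQ1 : ∀ t i, Q t i ≤ 1 := fun t i =>
    div_le_one_of_le₀ (le_max_right _ _) (le_max_of_le_left (hq0 i))
  let α : T → I → J → ℝ := fun t i j => w i j / (max (p i) (p' t i) * max (q j) (q' t j))
  have hα0 : ∀ t i j, 0 ≤ α t i j := fun t i j => div_nonneg (hw i j)
    (mul_nonneg (le_max_of_le_left (hp0 i)) (le_max_of_le_left (hq0 j)))
  have hαc : ∀ i j, Continuous fun t => α t i j := by
    intro i j
    rcases (hw i j).eq_or_lt with h0 | h0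
    · simp only [α, ← h0, zero_div]; exact continuous_const
    · refine continuous_const.div ((continuous_const.max (hp'c i)).mul
        (continuous_const.max (hq'c j))) fun t => ?_
      exact (mul_pos (lt_max_of_lt_left (h0.trans_le (hwp i j)))
        (lt_max_of_lt_left (h0.trans_le (hwq i j)))).ne'
  have hαq : ∀ t i, ∑ j, α t i j * q' t j ≤ 1 := by
    intro t i
    calc ∑ j, α t i j * q' t j ≤ ∑ j, w i j / max (p i) (p' t i) := by
          apply Finset.sum_le_sum
          intro j _
          have : α t i j * q' t j = w i j / max (p i) (p' t i) * Q t j := by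
            simp only [α, Q]; rw [div_mul_div_comm, div_mul_eq_mul_div]
          rw [this]
          exact mul_le_of_le_one_right (div_nonneg (hw i j) (le_max_of_le_left (hp0 i))) (hQ1 t j)
      _ = p i / max (p i) (p' t i) := by rw [← Finset.sum_div, hp]
      _ ≤ 1 := div_le_one_of_le₀ (le_max_left _ _) (le_max_of_le_left (hp0 i))
  have hαp : ∀ t j, ∑ i, α t i j * p' t i ≤ 1 := by
    intro t j
    calc ∑ i, α t i j * p' t i ≤ ∑ i, w i j / max (q j) (q' t j) := by
          apply Finset.sum_le_sum
          intro i _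
          have : α t i j * p' t i = w i j / max (q j) (q' t j) * P t i := by
            simp only [α, P]
            rw [div_mul_div_comm, div_mul_eq_mul_div, mul_comm (max (q j) _)]
          rw [this]
          exact mul_le_of_le_one_right (div_nonneg (hw i j) (le_max_of_le_left (hq0 j))) (hP1 t i)
      _ = q j / max (q j) (q' t j) := by rw [← Finset.sum_div, hq]
      _ ≤ 1 := div_le_one_of_le₀ (le_max_left _ _) (le_max_of_le_left (hq0 j))
  have hαpq : ∀ t i j, α t i j * (p' t i * q' t j) = w i j * (P t i * Q t j) := by
    intro t i j
    simp only [α, P, Q]; rw [div_mul_div_comm, div_mul_eq_mul_div, mul_div_assoc]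
  let s : T → ℝ := fun t => ∑ i, ∑ j, α t i j * (p' t i * q' t j)
  have hs1 : ∀ t, s t ≤ 1 := by
    intro t
    calc s t = ∑ i, (∑ j, α t i j * q' t j) * p' t i := by
          simp only [s, Finset.sum_mul]
          exact Finset.sum_congr rfl fun i _ => Finset.sum_congr rfl fun j _ => by ring
      _ ≤ ∑ i, 1 * p' t i :=
          Finset.sum_le_sum fun i _ => mul_le_mul_of_nonneg_right (hαq t i) (hp'0 t i)
      _ = 1 := by simp [hp'1]
  have hs2 : ∀ t, 1 - s t ≤ ∑ i, |p i - p' t i| + ∑ j, |q j - q' t j| := by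
    intro t
    have e1 : (1 : ℝ) = ∑ i, ∑ j, w i j := by simp [hp, hp1]
    have hPP : ∀ i, p i * (1 - P t i) ≤ |p i - p' t i| := by
      intro i
      rcases le_total (p i) (p' t i) with hle | hle
      · simp only [P, max_eq_right hle]
        rcases (hp'0 t i).eq_or_lt with h0 | h0
        · have : p i = 0 := le_antisymm (hle.trans_eq h0.symm) (hp0 i)
          simp [this]
        · rw [div_self h0.ne']; simp
      · simp only [P, max_eq_left hle]
        rcases (hp0 i).eq_or_lt with h0 | h0
        · simp [← h0]
        · rw [mul_sub, mul_div_cancel₀ _ h0.ne', mul_one]; exact le_abs_self _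
    have hQQ : ∀ i, q i * (1 - Q t i) ≤ |q i - q' t i| := by
      intro i
      rcases le_total (q i) (q' t i) with hle | hle
      · simp only [Q, max_eq_right hle]
        rcases (hq'0 t i).eq_or_lt with h0 | h0
        · have : q i = 0 := le_antisymm (hle.trans_eq h0.symm) (hq0 i)
          simp [this]
        · rw [div_self h0.ne']; simp
      · simp only [Q, max_eq_left hle]
        rcases (hq0 i).eq_or_lt with h0 | h0
        · simp [← h0]
        · rw [mul_sub, mul_div_cancel₀ _ h0.ne', mul_one]; exact le_abs_self _
    calc 1 - s t = ∑ i, ∑ j, w i j * (1 - P t i * Q t j) := by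
          simp only [s, hαpq, mul_sub, Finset.sum_sub_distrib, mul_one]
          rw [← e1]
      _ ≤ ∑ i, ∑ j, (w i j * (1 - P t i) + w i j * (1 - Q t j)) := by
          refine Finset.sum_le_sum fun i _ => Finset.sum_le_sum fun j _ => ?_
          rw [← mul_add]
          refine mul_le_mul_of_nonneg_left ?_ (hw i j)
          nlinarith [mul_nonneg (sub_nonneg.2 (hP1 t i)) (sub_nonneg.2 (hQ1 t j))]
      _ = ∑ i, p i * (1 - P t i) + ∑ j, q j * (1 - Q t j) := by
          simp only [Finset.sum_add_distrib, ← Finset.sum_mul, hp]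
          congr 1
          rw [Finset.sum_comm]
          simp only [← Finset.sum_mul, hq]
      _ ≤ _ := add_le_add (Finset.sum_le_sum fun i _ => hPP i)
          (Finset.sum_le_sum fun i _ => hQQ i)
  let u : T → I → ℝ := fun t i => 1 - c * ∑ j, α t i j * q' t j
  let v : T → J → ℝ := fun t j => 1 - c * ∑ i, α t i j * p' t i
  let m : T → ℝ := fun t => 1 - c * s t
  have hm : ∀ t, 0 < m t := fun t => by
    have := mul_le_mul_of_nonneg_left (hs1 t) hc0
    simp only [m]; linarith
  have hu0 : ∀ t i, 0 ≤ u t i := fun t i => by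
    have := mul_le_mul_of_nonneg_left (hαq t i) hc0
    simp only [u]; linarith
  have hv0 : ∀ t j, 0 ≤ v t j := fun t i => by
    have := mul_le_mul_of_nonneg_left (hαp t i) hc0
    simp only [v]; linarith
  have hup : ∀ t, ∑ i, u t i * p' t i = m t := by
    intro t
    simp only [u, m, s, sub_mul, one_mul, Finset.sum_sub_distrib, hp'1, Finset.mul_sum,
      Finset.sum_mul]
    congr 1
    exact Finset.sum_congr rfl fun i _ => Finset.sum_congr rfl fun j _ => by ring
  have hvq : ∀ t, ∑ j, v t j * q' t j = m t := by
    intro t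
    simp only [v, m, s, sub_mul, one_mul, Finset.sum_sub_distrib, hq'1, Finset.mul_sum,
      Finset.sum_mul]
    congr 1
    rw [Finset.sum_comm]
    exact Finset.sum_congr rfl fun i _ => Finset.sum_congr rfl fun j _ => by ring
  have hsc : Continuous s := continuous_finsetSum _ fun i _ => continuous_finsetSum _ fun j _ =>
    (hαc i j).mul ((hp'c i).mul (hq'c j))
  refine ⟨fun t i j => c * α t i j + u t i * v t j / m t, ?_, ?_, ?_, ?_, ?_⟩
  · intro i j
    refine (continuous_const.mul (hαc i j)).add (Continuous.div (Continuous.mul ?_ ?_) ?_ ?_)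
    · exact continuous_const.sub (continuous_const.mul
        (continuous_finsetSum _ fun j _ => (hαc i j).mul (hq'c j)))
    · exact continuous_const.sub (continuous_const.mul
        (continuous_finsetSum _ fun i _ => (hαc i j).mul (hp'c i)))
    · exact continuous_const.sub (continuous_const.mul hsc)
    · exact fun t => (hm t).ne'
  · intro t i j
    exact add_nonneg (mul_nonneg hc0 (hα0 t i j))
      (div_nonneg (mul_nonneg (hu0 t i) (hv0 t j)) (hm t).le)
  · intro t i
    have e : ∑ j, (c * α t i j + u t i * v t j / m t) * q' t j =
        c * (∑ j, α t i j * q' t j) + u t i / m t * ∑ j, v t j * q' t j := by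
      rw [Finset.mul_sum, Finset.mul_sum, ← Finset.sum_add_distrib]
      exact Finset.sum_congr rfl fun j _ => by ring
    rw [e, hvq, div_mul_cancel₀ _ (hm t).ne']
    simp only [u]; ring
  · intro t j
    have e : ∑ i, (c * α t i j + u t i * v t j / m t) * p' t i =
        c * (∑ i, α t i j * p' t i) + v t j / m t * ∑ i, u t i * p' t i := by
      rw [Finset.mul_sum, Finset.mul_sum, ← Finset.sum_add_distrib]
      exact Finset.sum_congr rfl fun j _ => by ring
    rw [e, hup, div_mul_cancel₀ _ (hm t).ne']
    simp only [v]; ring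
  · intro t hi M h0 hM
    have hbd : ∀ i j, hi i j * ((c * α t i j + u t i * v t j / m t) * (p' t i * q' t j)) ≤
        hi i j * w i j + M * ((u t i * p' t i) * (v t j * q' t j) / m t) := by
      intro i j
      have h1 : (c * α t i j + u t i * v t j / m t) * (p' t i * q' t j) =
        c * (w i j * (P t i * Q t j)) + (u t i * p' t i) * (v t j * q' t j) / m t := by
        rw [← hαpq]; ring
      rw [h1, mul_add]
      refine add_le_add (mul_le_mul_of_nonneg_left ?_ (h0 i j))
        (mul_le_mul_of_nonneg_right (hM i j) ?_)
      · have h2 : P t i * Q t j ≤ 1 := mul_le_one₀ (hP1 t i) (hQ0 t j) (hQ1 t j)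
        have h3 : w i j * (P t i * Q t j) ≤ w i j := mul_le_of_le_one_right (hw i j) h2
        have h4 : 0 ≤ w i j * (P t i * Q t j) :=
          mul_nonneg (hw i j) (mul_nonneg (hP0 t i) (hQ0 t j))
        nlinarith
      · exact div_nonneg (mul_nonneg (mul_nonneg (hu0 t i) (hp'0 t i))
          (mul_nonneg (hv0 t j) (hq'0 t j))) (hm t).le
    have hsum : ∑ i, ∑ j, M * ((u t i * p' t i) * (v t j * q' t j) / m t) = M * m t := by
      simp only [← Finset.mul_sum, ← Finset.sum_div, hvq, ← Finset.sum_mul, hup]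
      rw [mul_div_assoc, div_self (hm t).ne', mul_one]
    have hM0 : 0 ≤ M := by
      have : Nonempty I := by
        by_contra hcon
        rw [not_nonempty_iff] at hcon
        simp at hp1
      have : Nonempty J := by
        by_contra hcon
        rw [not_nonempty_iff] at hcon
        have := hq'1 t
        simp at this
      obtain ⟨i⟩ := ‹Nonempty I›
      obtain ⟨j⟩ := ‹Nonempty J›
      exact (h0 i j).trans (hM i j)
    calc _ ≤ ∑ i, ∑ j, (hi i j * w i j + M * ((u t i * p' t i) * (v t j * q' t j) / m t)) :=
          Finset.sum_le_sum fun i _ => Finset.sum_le_sum fun j _ => hbd i j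
      _ = ∑ i, ∑ j, hi i j * w i j + M * m t := by
          simp only [Finset.sum_add_distrib] at hsum ⊢
          rw [hsum]
      _ ≤ _ := by
          refine add_le_add le_rfl (mul_le_mul_of_nonneg_left ?_ hM0)
          have := hs2 t
          have := hs1 t
          simp only [m]
          nlinarith

theorem aux_compact {X : Type*} [MetricSpace X] [MeasurableSpace X] [BorelSpace X]
    (μ : Measure X) [IsProbabilityMeasure μ] [μ.InnerRegular] (η : ℝ) (hη : 0 < η) :
    ∃ K : Set X, IsCompact K ∧ K.Nonempty ∧ ∀ φ : X → ℝ, Continuous φ → (∀ x, 0 ≤ φ x) →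
      (∀ x, φ x ≤ 1) → (∀ x ∈ K, φ x = 0) → ∫ x, φ x ∂μ ≤ η := by
  obtain ⟨K, _, hK, hKμ⟩ := MeasurableSet.univ.exists_isCompact_sdiff_lt (μ := μ)
    (measure_ne_top μ _) (ENNReal.ofReal_pos.2 hη).ne'
  have : Nonempty X := nonempty_of_isProbabilityMeasure μ
  obtain ⟨x0⟩ := this
  refine ⟨insert x0 K, hK.insert x0, Set.insert_nonempty _ _, fun φ hφ h0 h1 hz => ?_⟩
  have hms : MeasurableSet (Kᶜ) := hK.measurableSet.compl
  calc ∫ x, φ x ∂μ ≤ ∫ x, (Kᶜ).indicator (fun _ => (1 : ℝ)) x ∂μ := by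
        refine integral_mono_of_nonneg (Eventually.of_forall h0)
          ((integrable_const (1 : ℝ)).indicator hms) (Eventually.of_forall fun x => ?_)
        by_cases hx : x ∈ K
        · simp [hx, hz x (Set.mem_insert_of_mem _ hx)]
        · simpa [hx] using h1 x
    _ = μ.real (Kᶜ) := by
        rw [integral_indicator hms]; simp
    _ ≤ η := by
        rw [Set.compl_eq_univ_sdiff]
        exact ENNReal.toReal_le_of_le_ofReal hη.le hKμ.le

theorem aux_cells {X Y T : Type*} [MetricSpace X] [MeasurableSpace X] [BorelSpace X]
    [MetricSpace Y] [MeasurableSpace Y] [BorelSpace Y] [MetricSpace T]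
    (μ : Measure X) (ν : Measure Y) [IsProbabilityMeasure μ] [μ.InnerRegular]
    [IsProbabilityMeasure ν] [ν.InnerRegular] (F : X × Y × T → ℝ) (hF : Continuous F)
    (M : ℝ) (hF0 : ∀ p, 0 ≤ F p) (hFM : ∀ p, F p ≤ M) (t₀ : T) (η : ℝ) (hη : 0 < η) :
    ∃ (r : Finset X) (s : Finset Y) (φ : Option r → X → ℝ) (ψ : Option s → Y → ℝ)
      (lo hi : Option r → Option s → ℝ),
      ((∀ i, Continuous (φ i)) ∧ (∀ i x, 0 ≤ φ i x) ∧ (∀ x, ∑ i, φ i x = 1) ∧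
        ∫ x, φ none x ∂μ ≤ η) ∧
      ((∀ i, Continuous (ψ i)) ∧ (∀ i x, 0 ≤ ψ i x) ∧ (∀ x, ∑ i, ψ i x = 1) ∧
        ∫ x, ψ none x ∂ν ≤ η) ∧
      (∀ i j, 0 ≤ lo i j) ∧ (∀ i j, 0 ≤ hi i j) ∧ (∀ i j, hi i j ≤ M) ∧
      (∀ i j, hi i j - lo i j ≤ M) ∧
      (∀ i j, hi (some i) (some j) - lo (some i) (some j) ≤ 2 * η) ∧
      (∀ᶠ t in 𝓝 t₀, ∀ i j x y, φ i x ≠ 0 → ψ j y ≠ 0 →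
        lo i j ≤ F (x, y, t) ∧ F (x, y, t) ≤ hi i j) := by
  obtain ⟨K, hK, hKn, hKμ⟩ := aux_compact μ η hη
  obtain ⟨L, hL, hLn, hLν⟩ := aux_compact ν η hη
  have hc : IsCompact (K ×ˢ L ×ˢ ({t₀} : Set T)) := hK.prod (hL.prod isCompact_singleton)
  have hu := hc.uniformContinuousAt_of_continuousAt F (fun a _ => hF.continuousAt)
    (Metric.dist_mem_uniformity hη)
  obtain ⟨δ, hδ, hδu⟩ := Metric.mem_uniformity_dist.1 hu
  have hM0 : 0 ≤ M := by
    obtain ⟨x, _⟩ := hKn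
    obtain ⟨y, _⟩ := hLn
    exact (hF0 (x, y, t₀)).trans (hFM _)
  obtain ⟨r, φ, hrK, hφc, hφ0, hφ1, hφn, hφd⟩ := aux_partition K hK hKn δ hδ
  obtain ⟨s, ψ, hsL, hψc, hψ0, hψ1, hψn, hψd⟩ := aux_partition L hL hLn δ hδ
  have hφle : ∀ i x, φ i x ≤ 1 := fun i x => by
    rw [← hφ1 x]
    exact Finset.single_le_sum (f := fun i => φ i x) (fun i _ => hφ0 i x) (Finset.mem_univ i)
  have hψle : ∀ i x, ψ i x ≤ 1 := fun i x => by
    rw [← hψ1 x]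
    exact Finset.single_le_sum (f := fun i => ψ i x) (fun i _ => hψ0 i x) (Finset.mem_univ i)
  refine ⟨r, s, φ, ψ, fun i j => match i, j with
      | some i, some j => max 0 (F (i, j, t₀) - η)
      | _, _ => 0, fun i j => match i, j with
      | some i, some j => min M (F (i, j, t₀) + η)
      | _, _ => M,
    ⟨hφc, hφ0, hφ1, hKμ _ (hφc none) (hφ0 none) (hφle none) hφn⟩,
    ⟨hψc, hψ0, hψ1, hLν _ (hψc none) (hψ0 none) (hψle none) hψn⟩, ?_, ?_, ?_, ?_, ?_, ?_⟩
  · rintro (_ | i) (_ | j) <;> simp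
  · rintro (_ | i) (_ | j) <;> simp [hM0]
    have := hF0 (↑i, ↑j, t₀)
    linarith
  · rintro (_ | i) (_ | j) <;> simp
  · rintro (_ | i) (_ | j) <;> simp
  · intro i j
    have h1 : min M (F (↑i, ↑j, t₀) + η) ≤ _ := min_le_right _ _
    have h2 : _ ≤ max 0 (F (↑i, ↑j, t₀) - η) := le_max_right _ _
    show min M (F (↑i, ↑j, t₀) + η) - max 0 (F (↑i, ↑j, t₀) - η) ≤ _
    linarith
  · filter_upwards [Metric.ball_mem_nhds t₀ hδ] with t ht
    rintro (_ | i) (_ | j) x y hx hy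
    · exact ⟨hF0 _, hFM _⟩
    · exact ⟨hF0 _, hFM _⟩
    · exact ⟨hF0 _, hFM _⟩
    · have h1 := hφd i x hx
      have h2 := hψd j y hy
      have h3 : dist ((i : X), (j : Y), t₀) (x, y, t) < δ := by
        rw [dist_comm]
        simp only [Prod.dist_eq, max_lt_iff]
        exact ⟨h1, h2, ht⟩
      have h4 := hδu h3
      simp only [Set.mem_ofPred_eq] at h4
      have h5 := h4 ⟨hrK _ i.2, hsL _ j.2, rfl⟩
      rw [Real.dist_eq, abs_lt] at h5
      exact ⟨max_le (hF0 _) (by linarith [h5.2]), le_min (hFM _) (by linarith [h5.1])⟩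

theorem aux_none_sum {r s : Type*} [Fintype r] [Fintype s]
    (lo hi w : Option r → Option s → ℝ) (p : Option r → ℝ) (q : Option s → ℝ) (M η : ℝ)
    (hη : 0 ≤ η) (hM : 0 ≤ M) (hw : ∀ i j, 0 ≤ w i j) (hp : ∀ i, ∑ j, w i j = p i)
    (hq : ∀ j, ∑ i, w i j = q j) (hp1 : ∑ i, p i = 1)
    (h1 : ∀ i j, hi i j - lo i j ≤ M)
    (h2 : ∀ i j, hi (some i) (some j) - lo (some i) (some j) ≤ 2 * η) :
    ∑ i, ∑ j, hi i j * w i j ≤ ∑ i, ∑ j, lo i j * w i j + (2 * η + M * (p none + q none)) := by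
  have key : ∀ i j, hi i j * w i j ≤ lo i j * w i j + (2 * η * w i j +
      M * ((if i = none then w i j else 0) + (if j = none then w i j else 0))) := by
    rintro (_ | i) (_ | j)
    · have := mul_le_mul_of_nonneg_right (h1 none none) (hw none none)
      have := mul_nonneg hη (hw none none)
      have := mul_nonneg hM (hw none none)
      simp; nlinarith
    · have := mul_le_mul_of_nonneg_right (h1 none (some j)) (hw none (some j))
      have := mul_nonneg hη (hw none (some j))
      simp; nlinarith
    · have := mul_le_mul_of_nonneg_right (h1 (some i) none) (hw (some i) none)
      have := mul_nonneg hη (hw (some i) none)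
      simp; nlinarith
    · have := mul_le_mul_of_nonneg_right (h2 i j) (hw (some i) (some j))
      simp; nlinarith
  have e1 : ∑ i, ∑ j, w i j = 1 := by simp only [hp, hp1]
  have e2 : ∑ i, ∑ j, (if i = none then w i j else 0) = p none := by
    rw [Finset.sum_eq_single none]
    · simp [← hp]
    · intro b _ hb; simp [hb]
    · simp
  have e3 : ∑ i, ∑ j, (if j = none then w i j else 0) = q none := by
    rw [Finset.sum_comm, Finset.sum_eq_single none]
    · simp [← hq]
    · intro b _ hb; simp [hb]
    · simp
  calc _ ≤ ∑ i, ∑ j, (lo i j * w i j + (2 * η * w i j +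
      M * ((if i = none then w i j else 0) + (if j = none then w i j else 0)))) :=
        Finset.sum_le_sum fun i _ => Finset.sum_le_sum fun j _ => key i j
    _ = _ := by
      simp only [Finset.sum_add_distrib, ← Finset.mul_sum, e1, e2, e3]
      simp only [mul_one]

/-- cells data gives two sided bounds for the cost of a coupling -/
theorem aux_cell_integral {X Y I J : Type*} [MetricSpace X] [MeasurableSpace X] [BorelSpace X]
    [MetricSpace Y] [MeasurableSpace Y] [BorelSpace Y] [Fintype I] [Fintype J]
    (μ : Measure X) (ν : Measure Y) [IsProbabilityMeasure μ] [IsProbabilityMeasure ν]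
    (σ : Measure (X × Y)) (hσ : IsCoupling σ μ ν)
    (φ : I → X → ℝ) (ψ : J → Y → ℝ)
    (hφc : ∀ i, Continuous (φ i)) (hφ0 : ∀ i x, 0 ≤ φ i x) (hφ1 : ∀ x, ∑ i, φ i x = 1)
    (hψc : ∀ i, Continuous (ψ i)) (hψ0 : ∀ i x, 0 ≤ ψ i x) (hψ1 : ∀ x, ∑ i, ψ i x = 1) :
    (∀ i j, Integrable (fun z : X × Y => φ i z.1 * ψ j z.2) σ) ∧
    (∀ i j, 0 ≤ ∫ z, φ i z.1 * ψ j z.2 ∂σ) ∧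
    (∀ i, ∑ j, ∫ z, φ i z.1 * ψ j z.2 ∂σ = ∫ x, φ i x ∂μ) ∧
    (∀ j, ∑ i, ∫ z, φ i z.1 * ψ j z.2 ∂σ = ∫ y, ψ j y ∂ν) ∧
    (∑ i, ∫ x, φ i x ∂μ = 1) ∧ (∑ j, ∫ x, ψ j x ∂ν = 1) ∧
    (∀ c : I → J → ℝ, (∀ i j, 0 ≤ c i j) →
      ∫⁻ z, ENNReal.ofReal (∑ i, ∑ j, c i j * (φ i z.1 * ψ j z.2)) ∂σ =
        ENNReal.ofReal (∑ i, ∑ j, c i j * ∫ z, φ i z.1 * ψ j z.2 ∂σ)) := by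
  have hφle : ∀ i x, φ i x ≤ 1 := fun i x => by
    rw [← hφ1 x]
    exact Finset.single_le_sum (f := fun i => φ i x) (fun i _ => hφ0 i x) (Finset.mem_univ i)
  have hψle : ∀ i x, ψ i x ≤ 1 := fun i x => by
    rw [← hψ1 x]
    exact Finset.single_le_sum (f := fun i => ψ i x) (fun i _ => hψ0 i x) (Finset.mem_univ i)
  have hfin : IsFiniteMeasure σ := by
    refine ⟨?_⟩
    have : σ Set.univ = μ Set.univ := by
      rw [← hσ.1, Measure.map_apply measurable_fst MeasurableSet.univ, Set.preimage_univ]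
    rw [this]
    exact measure_lt_top _ _
  have hint : ∀ i j, Integrable (fun z : X × Y => φ i z.1 * ψ j z.2) σ := by
    intro i j
    refine Integrable.of_bound (Measurable.aestronglyMeasurable
      (((hφc i).measurable.comp measurable_fst).mul ((hψc j).measurable.comp measurable_snd))) 1
      (Eventually.of_forall fun z => ?_)
    rw [Real.norm_of_nonneg (mul_nonneg (hφ0 _ _) (hψ0 _ _))]
    exact mul_le_one₀ (hφle _ _) (hψ0 _ _) (hψle _ _)
  have hφi : ∀ i, Integrable (φ i) μ := fun i => Integrable.of_bound
    (hφc i).measurable.aestronglyMeasurable 1 (Eventually.of_forall fun z => by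
      rw [Real.norm_of_nonneg (hφ0 _ _)]; exact hφle _ _)
  have hψi : ∀ i, Integrable (ψ i) ν := fun i => Integrable.of_bound
    (hψc i).measurable.aestronglyMeasurable 1 (Eventually.of_forall fun z => by
      rw [Real.norm_of_nonneg (hψ0 _ _)]; exact hψle _ _)
  refine ⟨hint, fun i j => integral_nonneg fun z => mul_nonneg (hφ0 _ _) (hψ0 _ _),
    ?_, ?_, ?_, ?_, ?_⟩
  · intro i
    rw [← integral_finsetSum _ fun j _ => hint i j]
    simp only [← Finset.mul_sum, hψ1, mul_one]
    rw [← hσ.1, integral_map measurable_fst.aemeasurable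
      (hφc i).measurable.aestronglyMeasurable]
  · intro j
    rw [← integral_finsetSum _ fun i _ => hint i j]
    simp only [← Finset.sum_mul, hφ1, one_mul]
    rw [← hσ.2, integral_map measurable_snd.aemeasurable
      (hψc j).measurable.aestronglyMeasurable]
  · rw [← integral_finsetSum _ fun i _ => hφi i]
    simp [hφ1]
  · rw [← integral_finsetSum _ fun i _ => hψi i]
    simp [hψ1]
  · intro c hc
    rw [← ofReal_integral_eq_lintegral_ofReal]
    · rw [integral_finsetSum _ fun i _ => integrable_finsetSum _ fun j _ =>
        (hint i j).const_mul _]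
      congr 1
      refine Finset.sum_congr rfl fun i _ => ?_
      rw [integral_finsetSum _ fun j _ => (hint i j).const_mul _]
      refine Finset.sum_congr rfl fun j _ => ?_
      rw [integral_const_mul]
    · exact integrable_finsetSum _ fun i _ => integrable_finsetSum _ fun j _ =>
        (hint i j).const_mul _
    · exact Eventually.of_forall fun z => Finset.sum_nonneg fun i _ => Finset.sum_nonneg
        fun j _ => mul_nonneg (hc i j) (mul_nonneg (hφ0 _ _) (hψ0 _ _))

theorem aux_wc {X T : Type*} [TopologicalSpace T] [TopologicalSpace X] [MeasurableSpace X]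
    (μ : T → Measure X) (hμ : WeaklyContinuousFamily μ) (φ : X → ℝ) (hφ : Continuous φ)
    (C : ℝ) (hC : ∀ x, |φ x| ≤ C) : Continuous fun t => ∫ x, φ x ∂(μ t) :=
  hμ (BoundedContinuousFunction.ofNormedAddCommGroup φ hφ C hC)

theorem aux_pt {I J : Type*} [Fintype I] [Fintype J] (a : I → ℝ) (b : J → ℝ)
    (ha0 : ∀ i, 0 ≤ a i) (ha1 : ∑ i, a i = 1) (hb0 : ∀ i, 0 ≤ b i) (hb1 : ∑ i, b i = 1)
    (lo hi : I → J → ℝ) (v : ℝ)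
    (hv : ∀ i j, a i ≠ 0 → b j ≠ 0 → lo i j ≤ v ∧ v ≤ hi i j) :
    ∑ i, ∑ j, lo i j * (a i * b j) ≤ v ∧ v ≤ ∑ i, ∑ j, hi i j * (a i * b j) := by
  have e : v = ∑ i, ∑ j, v * (a i * b j) := by
    simp only [← Finset.mul_sum, hb1, ha1, mul_one]
  constructor
  · conv_rhs => rw [e]
    refine Finset.sum_le_sum fun i _ => Finset.sum_le_sum fun j _ => ?_
    by_cases h1 : a i = 0
    · simp [h1]
    by_cases h2 : b j = 0
    · simp [h2]
    exact mul_le_mul_of_nonneg_right (hv i j h1 h2).1 (mul_nonneg (ha0 i) (hb0 j))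
  · conv_lhs => rw [e]
    refine Finset.sum_le_sum fun i _ => Finset.sum_le_sum fun j _ => ?_
    by_cases h1 : a i = 0
    · simp [h1]
    by_cases h2 : b j = 0
    · simp [h2]
    exact mul_le_mul_of_nonneg_right (hv i j h1 h2).2 (mul_nonneg (ha0 i) (hb0 j))

theorem aux_le_one {I X : Type*} [Fintype I] (φ : I → X → ℝ)
    (hφ0 : ∀ i x, 0 ≤ φ i x) (hφ1 : ∀ x, ∑ i, φ i x = 1) (i : I) (x : X) : |φ i x| ≤ 1 := by
  rw [abs_of_nonneg (hφ0 i x), ← hφ1 x]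
  exact Finset.single_le_sum (f := fun i => φ i x) (fun i _ => hφ0 i x) (Finset.mem_univ i)

theorem aux_prod_cont {X Y T : Type*} [MetricSpace X] [MeasurableSpace X] [BorelSpace X]
    [MetricSpace Y] [MeasurableSpace Y] [BorelSpace Y] [MetricSpace T]
    (μ : T → Measure X) (ν : T → Measure Y)
    (hμp : ∀ t, IsProbabilityMeasure (μ t)) (hνp : ∀ t, IsProbabilityMeasure (ν t))
    (hμr : ∀ t, (μ t).InnerRegular) (hνr : ∀ t, (ν t).InnerRegular)
    (hμc : WeaklyContinuousFamily μ) (hνc : WeaklyContinuousFamily ν)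
    (g : X × Y → ℝ) (hg : Continuous g) (C : ℝ) (hC : ∀ p, |g p| ≤ C) :
    Continuous fun t => ∫ z, g z ∂((μ t).prod (ν t)) := by
  have hgint : ∀ t, Integrable g ((μ t).prod (ν t)) := fun t =>
    aux_integrable (μ t) (ν t) _ (aux_prod_coupling _ _) g hg C hC
  rw [continuous_iff_continuousAt]
  intro t₀
  rw [Metric.continuousAt_iff']
  intro e he
  have hC0 : 0 ≤ C := by
    have := nonempty_of_isProbabilityMeasure ((μ t₀).prod (ν t₀))
    obtain ⟨z⟩ := this
    exact (abs_nonneg _).trans (hC z)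
  obtain ⟨η, hη⟩ : ∃ η, η = e / (2 * (2 + 2 * C * 4)) := ⟨_, rfl⟩
  have hηpos : 0 < η := by rw [hη]; positivity
  have hηe : 2 * η + 2 * C * (2 * η + 2 * η) = e / 2 := by
    rw [hη]; field_simp; ring
  obtain ⟨r, s, φ, ψ, lo, hi, ⟨hφc, hφ0, hφ1, hφn⟩, ⟨hψc, hψ0, hψ1, hψn⟩, hlo0, hhi0, hhiM, hM,
    h2η, hev⟩ := aux_cells (μ t₀) (ν t₀) (fun p : X × Y × T => g (p.1, p.2.1) + C)
      ((hg.comp (by fun_prop)).add continuous_const) (2 * C)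
      (fun p => by have := abs_le.1 (hC (p.1, p.2.1)); linarith [this.1])
      (fun p => by have := abs_le.1 (hC (p.1, p.2.1)); linarith [this.2]) t₀ η hηpos
  have hpc : ∀ i, Continuous fun t => ∫ x, φ i x ∂(μ t) := fun i =>
    aux_wc μ hμc (φ i) (hφc i) 1 (aux_le_one φ hφ0 hφ1 i)
  have hqc : ∀ i, Continuous fun t => ∫ x, ψ i x ∂(ν t) := fun i =>
    aux_wc ν hνc (ψ i) (hψc i) 1 (aux_le_one ψ hψ0 hψ1 i)
  let A : T → ℝ := fun t => ∑ i, ∑ j, lo i j * ((∫ x, φ i x ∂(μ t)) * ∫ y, ψ j y ∂(ν t))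
  have hA : Continuous A := continuous_finsetSum _ fun i _ => continuous_finsetSum _ fun j _ =>
    continuous_const.mul ((hpc i).mul (hqc j))
  have hbd : ∀ᶠ t in 𝓝 t₀, A t ≤ ∫ z, g z ∂((μ t).prod (ν t)) + C ∧
      ∫ z, g z ∂((μ t).prod (ν t)) + C ≤ A t + e / 2 := by
    have n1 : ∀ᶠ t in 𝓝 t₀, ∫ x, φ none x ∂(μ t) < 2 * η :=
      (hpc none).continuousAt.eventually_lt continuousAt_const (by linarith)
    have n2 : ∀ᶠ t in 𝓝 t₀, ∫ x, ψ none x ∂(ν t) < 2 * η :=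
      (hqc none).continuousAt.eventually_lt continuousAt_const (by linarith)
    filter_upwards [hev, n1, n2] with t ht h1 h2
    obtain ⟨c1, c2, c3, c4, c5, c6, -⟩ := aux_cell_integral (μ t) (ν t) ((μ t).prod (ν t))
      (aux_prod_coupling _ _) φ ψ hφc hφ0 hφ1 hψc hψ0 hψ1
    have hns := aux_none_sum lo hi (fun i j => ∫ z, φ i z.1 * ψ j z.2 ∂((μ t).prod (ν t)))
      (fun i => ∫ x, φ i x ∂(μ t)) (fun j => ∫ x, ψ j x ∂(ν t)) (2 * C) η hηpos.le (by linarith)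
      c2 c3 c4 c5 hM h2η
    have e1 : ∫ z, g z ∂((μ t).prod (ν t)) + C = ∫ z, (g z + C) ∂((μ t).prod (ν t)) := by
      rw [integral_add (hgint t) (integrable_const _)]; simp
    have hsi : ∀ c : Option r → Option s → ℝ, Integrable (fun z : X × Y =>
        ∑ i, ∑ j, c i j * (φ i z.1 * ψ j z.2)) ((μ t).prod (ν t)) := fun c =>
      integrable_finsetSum _ fun i _ => integrable_finsetSum _ fun j _ => (c1 i j).const_mul _
    have hse : ∀ c : Option r → Option s → ℝ, ∫ z, 
        ∑ i, ∑ j, c i j * (φ i z.1 * ψ j z.2) ∂((μ t).prod (ν t)) =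
        ∑ i, ∑ j, c i j * ∫ z, φ i z.1 * ψ j z.2 ∂((μ t).prod (ν t)) := by
      intro c
      rw [integral_finsetSum _ fun i _ => integrable_finsetSum _ fun j _ =>
        (c1 i j).const_mul _]
      refine Finset.sum_congr rfl fun i _ => ?_
      rw [integral_finsetSum _ fun j _ => (c1 i j).const_mul _]
      refine Finset.sum_congr rfl fun j _ => ?_
      rw [integral_const_mul]
    have hpt : ∀ z : X × Y, _ := fun z => aux_pt (fun i => φ i z.1) (fun j => ψ j z.2)
      (fun i => hφ0 i _) (hφ1 _) (fun i => hψ0 i _) (hψ1 _) lo hi (g z + C)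
      (fun i j a b => ht i j z.1 z.2 a b)
    have hAe : A t = ∑ i, ∑ j, lo i j * ∫ z, φ i z.1 * ψ j z.2 ∂((μ t).prod (ν t)) := by
      simp only [A, integral_prod_mul]
    rw [e1]
    have hgC : Integrable (fun z => g z + C) ((μ t).prod (ν t)) :=
      (hgint t).add (integrable_const C)
    constructor
    · rw [hAe, ← hse]
      exact integral_mono (hsi lo) hgC fun z => (hpt z).1
    · have h3 : ∫ z, (g z + C) ∂((μ t).prod (ν t)) ≤ _ :=
        integral_mono hgC (hsi hi) fun z => (hpt z).2
      rw [hse] at h3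
      rw [hAe]
      refine h3.trans (hns.trans ?_)
      have : 2 * C * (∫ x, φ none x ∂(μ t) + ∫ x, ψ none x ∂(ν t)) ≤
        2 * C * (2 * η + 2 * η) := mul_le_mul_of_nonneg_left (by linarith) (by linarith)
      linarith
  have hb0 := hbd.self_of_nhds
  have hA' := Metric.continuousAt_iff'.1 (hA.continuousAt (x := t₀)) (e / 2) (by linarith)
  filter_upwards [hbd, hA'] with t h1 h2
  rw [Real.dist_eq, abs_lt] at h2 ⊢
  constructor <;> linarith [h1.1, h1.2, hb0.1, hb0.2, h2.1, h2.2]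

theorem aux_transfer {X Y T r s : Type*} [MetricSpace X] [MeasurableSpace X] [BorelSpace X]
    [MetricSpace Y] [MeasurableSpace Y] [BorelSpace Y] [MetricSpace T] [Fintype r] [Fintype s]
    (μ : T → Measure X) (ν : T → Measure Y)
    (hμp : ∀ t, IsProbabilityMeasure (μ t)) (hνp : ∀ t, IsProbabilityMeasure (ν t))
    (hμr : ∀ t, (μ t).InnerRegular) (hνr : ∀ t, (ν t).InnerRegular)
    (hμc : WeaklyContinuousFamily μ) (hνc : WeaklyContinuousFamily ν)
    (φ : Option r → X → ℝ) (ψ : Option s → Y → ℝ)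
    (hφc : ∀ i, Continuous (φ i)) (hφ0 : ∀ i x, 0 ≤ φ i x) (hφ1 : ∀ x, ∑ i, φ i x = 1)
    (hψc : ∀ i, Continuous (ψ i)) (hψ0 : ∀ i x, 0 ≤ ψ i x) (hψ1 : ∀ x, ∑ i, ψ i x = 1)
    (lo hi : Option r → Option s → ℝ) (M η : ℝ) (hη : 0 ≤ η) (hM0 : 0 ≤ M)
    (hlo0 : ∀ i j, 0 ≤ lo i j) (hhi0 : ∀ i j, 0 ≤ hi i j)
    (hhiM : ∀ i j, hi i j ≤ M) (hM : ∀ i j, hi i j - lo i j ≤ M)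
    (h2η : ∀ i j, hi (some i) (some j) - lo (some i) (some j) ≤ 2 * η)
    (κ : ℝ) (hκ : 0 < κ) (hκ1 : κ ≤ 1) (t₁ : T) (σ : Measure (X × Y))
    (hσ : IsCoupling σ (μ t₁) (ν t₁)) (F₁ : X × Y → ℝ)
    (hF₁ : ∀ i j x y, φ i x ≠ 0 → ψ j y ≠ 0 → lo i j ≤ F₁ (x, y)) :
    ∃ σ' : T → Measure (X × Y), (∀ t, IsCoupling (σ' t) (μ t) (ν t)) ∧
      WeaklyContinuousFamily σ' ∧
      ∀ t (F : X × Y → ℝ), (∀ i j x y, φ i x ≠ 0 → ψ j y ≠ 0 → F (x, y) ≤ hi i j) →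
        ∫⁻ z, ENNReal.ofReal (F z) ∂(σ' t) ≤ ∫⁻ z, ENNReal.ofReal (F₁ z) ∂σ +
          ENNReal.ofReal (2 * η + M * (∫ x, φ none x ∂(μ t₁) + ∫ x, ψ none x ∂(ν t₁)) +
            M * (κ + ∑ i, |∫ x, φ i x ∂(μ t₁) - ∫ x, φ i x ∂(μ t)| +
              ∑ i, |∫ x, ψ i x ∂(ν t₁) - ∫ x, ψ i x ∂(ν t)|)) := by
  have hpc : ∀ i, Continuous fun t => ∫ x, φ i x ∂(μ t) := fun i =>
    aux_wc μ hμc (φ i) (hφc i) 1 (aux_le_one φ hφ0 hφ1 i)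
  have hqc : ∀ i, Continuous fun t => ∫ x, ψ i x ∂(ν t) := fun i =>
    aux_wc ν hνc (ψ i) (hψc i) 1 (aux_le_one ψ hψ0 hψ1 i)
  obtain ⟨c1, c2, c3, c4, c5, c6, c7⟩ := aux_cell_integral (μ t₁) (ν t₁) σ
      hσ φ ψ hφc hφ0 hφ1 hψc hψ0 hψ1
  have D := fun t => aux_cell_integral (μ t) (ν t) ((μ t).prod (ν t))
      (aux_prod_coupling _ _) φ ψ hφc hφ0 hφ1 hψc hψ0 hψ1
  have hφi : ∀ t i, Integrable (φ i) (μ t) := fun t i => Integrable.of_bound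
    (hφc i).measurable.aestronglyMeasurable 1 (Eventually.of_forall (aux_le_one φ hφ0 hφ1 i))
  have hψi : ∀ t i, Integrable (ψ i) (ν t) := fun t i => Integrable.of_bound
    (hψc i).measurable.aestronglyMeasurable 1 (Eventually.of_forall (aux_le_one ψ hψ0 hψ1 i))
  have hns := aux_none_sum lo hi (fun i j => ∫ z, φ i z.1 * ψ j z.2 ∂σ)
      (fun i => ∫ x, φ i x ∂(μ t₁)) (fun j => ∫ x, ψ j x ∂(ν t₁)) M η hη hM0
      c2 c3 c4 c5 hM h2η
  obtain ⟨β, hβc, hβ0, hβq, hβp, hβw⟩ := aux_fd (fun i j => ∫ z, φ i z.1 * ψ j z.2 ∂σ)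
    (fun i => ∫ x, φ i x ∂(μ t₁)) (fun j => ∫ x, ψ j x ∂(ν t₁))
    (fun t i => ∫ x, φ i x ∂(μ t)) (fun t j => ∫ x, ψ j x ∂(ν t)) c2 c3 c4 c5
    (fun t i => integral_nonneg (hφ0 i)) (fun t i => integral_nonneg (hψ0 i))
    (fun t => (D t).2.2.2.2.1) (fun t => (D t).2.2.2.2.2.1) hpc hqc κ hκ hκ1
  let k : T → X × Y → ℝ := fun t z => ∑ i, ∑ j, β t i j * (φ i z.1 * ψ j z.2)
  have hk0 : ∀ t z, 0 ≤ k t z := fun t z => Finset.sum_nonneg fun i _ => Finset.sum_nonneg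
        fun j _ => mul_nonneg (hβ0 t i j) (mul_nonneg (hφ0 _ _) (hψ0 _ _))
  have hkm : ∀ t, Measurable (k t) := fun t => Finset.measurable_fun_sum _ fun i _ =>
    Finset.measurable_fun_sum _ fun j _ => Measurable.const_mul
      (((hφc i).measurable.comp measurable_fst).mul ((hψc j).measurable.comp measurable_snd)) _
  have hkm' : ∀ t, Measurable fun z => ENNReal.ofReal (k t z) := fun t => (hkm t).ennreal_ofReal
  refine ⟨fun t => ((μ t).prod (ν t)).withDensity fun z => ENNReal.ofReal (k t z), ?_, ?_, ?_⟩
  · intro t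
    constructor
    · ext B hB
      have hin : ∀ x, ∫⁻ y, ENNReal.ofReal (k t (x, y)) ∂(ν t) = 1 := by
        intro x
        have hii : ∀ i j, Integrable (fun y => β t i j * (φ i x * ψ j y)) (ν t) := fun i j =>
          ((hψi t j).const_mul _).const_mul _
        rw [← ofReal_integral_eq_lintegral_ofReal
          (integrable_finsetSum _ fun i _ => integrable_finsetSum _ fun j _ => hii i j)
          (Eventually.of_forall fun y => hk0 t (x, y)), ENNReal.ofReal_eq_one]
        rw [integral_finsetSum _ fun i _ => integrable_finsetSum _ fun j _ => hii i j,
          ← hφ1 x]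
        refine Finset.sum_congr rfl fun i _ => ?_
        rw [integral_finsetSum _ fun j _ => hii i j]
        simp only [integral_const_mul]
        have := congrArg (fun a => φ i x * a) (hβq t i)
        simp only [mul_one, Finset.mul_sum] at this
        exact Eq.trans (Finset.sum_congr rfl fun j _ => by ring) this
      rw [Measure.map_apply measurable_fst hB, withDensity_apply _ (measurable_fst hB),
        ← lintegral_indicator (measurable_fst hB), lintegral_prod _
        ((hkm' t).indicator (measurable_fst hB)).aemeasurable]
      have : ∀ x, ∫⁻ y, (Prod.fst ⁻¹' B : Set (X × Y)).indicator
          (fun z => ENNReal.ofReal (k t z)) (x, y) ∂(ν t) = B.indicator 1 x := by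
        intro x
        by_cases hx : x ∈ B
        · simp [Set.indicator, hx, hin]
        · simp [Set.indicator, hx]
      simp only [this]
      rw [lintegral_indicator_one hB]
    · ext B hB
      have hin : ∀ y, ∫⁻ x, ENNReal.ofReal (k t (x, y)) ∂(μ t) = 1 := by
        intro y
        have hii : ∀ i j, Integrable (fun x => β t i j * (φ i x * ψ j y)) (μ t) := fun i j =>
          ((hφi t i).mul_const _).const_mul _
        rw [← ofReal_integral_eq_lintegral_ofReal
          (integrable_finsetSum _ fun i _ => integrable_finsetSum _ fun j _ => hii i j)
          (Eventually.of_forall fun x => hk0 t (x, y)), ENNReal.ofReal_eq_one]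
        rw [integral_finsetSum _ fun i _ => integrable_finsetSum _ fun j _ => hii i j,
          ← hψ1 y]
        simp only [integral_finsetSum _ fun j _ => hii _ j]
        rw [Finset.sum_comm]
        refine Finset.sum_congr rfl fun j _ => ?_
        simp only [integral_const_mul, integral_mul_const]
        have := congrArg (fun a => ψ j y * a) (hβp t j)
        simp only [mul_one, Finset.mul_sum] at this
        exact Eq.trans (Finset.sum_congr rfl fun i _ => by ring) this
      rw [Measure.map_apply measurable_snd hB, withDensity_apply _ (measurable_snd hB),
        ← lintegral_indicator (measurable_snd hB), lintegral_prod_symm _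
        ((hkm' t).indicator (measurable_snd hB)).aemeasurable]
      have : ∀ y, ∫⁻ x, (Prod.snd ⁻¹' B : Set (X × Y)).indicator
          (fun z => ENNReal.ofReal (k t z)) (x, y) ∂(μ t) = B.indicator 1 y := by
        intro y
        by_cases hx : y ∈ B
        · simp [Set.indicator, hx, hin]
        · simp [Set.indicator, hx]
      simp only [this]
      rw [lintegral_indicator_one hB]
  · intro f
    have hfb : ∀ i j (z : X × Y), |φ i z.1 * ψ j z.2 * f z| ≤ ‖f‖ := by
      intro i j z
      rw [abs_mul, abs_mul]
      have h1 := aux_le_one φ hφ0 hφ1 i z.1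
      have h2 := aux_le_one ψ hψ0 hψ1 j z.2
      have h3 : |f z| ≤ ‖f‖ := f.norm_coe_le_norm z
      exact (mul_le_of_le_one_left (abs_nonneg _) (mul_le_one₀ h1 (abs_nonneg _) h2)).trans h3
    have hfc : ∀ i j, Continuous fun z : X × Y => φ i z.1 * ψ j z.2 * f z := fun i j =>
      (((hφc i).comp continuous_fst).mul ((hψc j).comp continuous_snd)).mul f.continuous
    have hfi : ∀ t i j, Integrable (fun z : X × Y => β t i j * (φ i z.1 * ψ j z.2 * f z))
        ((μ t).prod (ν t)) := fun t i j =>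
      (aux_integrable (μ t) (ν t) _ (aux_prod_coupling _ _) _ (hfc i j) _ (hfb i j)).const_mul _
    have : ∀ t, ∫ z, f z ∂(((μ t).prod (ν t)).withDensity fun z => ENNReal.ofReal (k t z)) =
        ∑ i, ∑ j, β t i j * ∫ z, φ i z.1 * ψ j z.2 * f z ∂((μ t).prod (ν t)) := by
      intro t
      rw [integral_withDensity_eq_integral_toReal_smul (hkm' t) (by simp)]
      have e : ∀ z, (ENNReal.ofReal (k t z)).toReal • f z =
          ∑ i, ∑ j, β t i j * (φ i z.1 * ψ j z.2 * f z) := by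
        intro z
        rw [ENNReal.toReal_ofReal (hk0 t z), smul_eq_mul]
        simp only [k, Finset.sum_mul]
        exact Finset.sum_congr rfl fun i _ => Finset.sum_congr rfl fun j _ => by ring
      simp only [e]
      rw [integral_finsetSum _ fun i _ => integrable_finsetSum _ fun j _ => hfi t i j]
      refine Finset.sum_congr rfl fun i _ => ?_
      rw [integral_finsetSum _ fun j _ => hfi t i j]
      refine Finset.sum_congr rfl fun j _ => ?_
      rw [integral_const_mul]
    simp only [this]
    exact continuous_finsetSum _ fun i _ => continuous_finsetSum _ fun j _ =>
      (hβc i j).mul (aux_prod_cont μ ν hμp hνp hμr hνr hμc hνc _ (hfc i j) _ (hfb i j))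
  · intro t F hF
    obtain ⟨d1, d2, d3, d4, d5, d6, d7⟩ := D t
    have u1 : ∫⁻ z, ENNReal.ofReal (F z) ∂(((μ t).prod (ν t)).withDensity
        fun z => ENNReal.ofReal (k t z)) ≤ ENNReal.ofReal (∑ i, ∑ j, (hi i j * β t i j) *
          ∫ z, φ i z.1 * ψ j z.2 ∂((μ t).prod (ν t))) := by
      rw [← d7 (fun i j => hi i j * β t i j) fun i j => mul_nonneg (hhi0 i j) (hβ0 t i j)]
      refine (lintegral_withDensity_le_lintegral_mul _ (hkm' t) _).trans
        (lintegral_mono fun z => ?_)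
      simp only [Pi.mul_apply]
      rw [← ENNReal.ofReal_mul (hk0 t z)]
      refine ENNReal.ofReal_le_ofReal ?_
      simp only [k, Finset.sum_mul]
      refine Finset.sum_le_sum fun i _ => Finset.sum_le_sum fun j _ => ?_
      by_cases h1 : φ i z.1 = 0
      · simp [h1]
      by_cases h2 : ψ j z.2 = 0
      · simp [h2]
      have h3 := mul_le_mul_of_nonneg_left (hF i j z.1 z.2 h1 h2)
        (mul_nonneg (hβ0 t i j) (mul_nonneg (hφ0 i z.1) (hψ0 j z.2)))
      linarith
    have l1 : ENNReal.ofReal (∑ i, ∑ j, lo i j * ∫ z, φ i z.1 * ψ j z.2 ∂σ) ≤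
        ∫⁻ z, ENNReal.ofReal (F₁ z) ∂σ := by
      rw [← c7 lo hlo0]
      refine lintegral_mono fun z => ENNReal.ofReal_le_ofReal ?_
      exact (aux_pt (fun i => φ i z.1) (fun j => ψ j z.2)
        (fun i => hφ0 i _) (hφ1 _) (fun i => hψ0 i _) (hψ1 _) lo (fun _ _ => F₁ z) (F₁ z)
        (fun i j a b => ⟨hF₁ i j z.1 z.2 a b, le_rfl⟩)).1
    have m1 := hβw t hi M hhi0 hhiM
    have e1 : ∑ i, ∑ j, (hi i j * β t i j) * ∫ z, φ i z.1 * ψ j z.2 ∂((μ t).prod (ν t)) =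
        ∑ i, ∑ j, hi i j * (β t i j * ((∫ x, φ i x ∂(μ t)) * ∫ y, ψ j y ∂(ν t))) := by
      simp only [integral_prod_mul, mul_assoc]
    rw [e1] at u1
    refine u1.trans ((ENNReal.ofReal_le_ofReal ?_).trans
      (ENNReal.ofReal_add_le.trans (add_le_add l1 le_rfl)))
    linarith

theorem aux_local {X Y T : Type*} [MetricSpace X] [MeasurableSpace X] [BorelSpace X]
    [MetricSpace Y] [MeasurableSpace Y] [BorelSpace Y] [MetricSpace T]
    (μ : T → Measure X) (ν : T → Measure Y)
    (hμp : ∀ t, IsProbabilityMeasure (μ t)) (hνp : ∀ t, IsProbabilityMeasure (ν t))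
    (hμr : ∀ t, (μ t).InnerRegular) (hνr : ∀ t, (ν t).InnerRegular)
    (hμc : WeaklyContinuousFamily μ) (hνc : WeaklyContinuousFamily ν)
    (F : X × Y × T → ℝ) (hF : Continuous F)
    (M : ℝ) (hF0 : ∀ p, 0 ≤ F p) (hFM : ∀ p, F p ≤ M) (t₀ : T) (ε : ℝ) (hε : 0 < ε) :
    ∃ U ∈ 𝓝 t₀, ∃ σ' : T → Measure (X × Y), (∀ t, IsCoupling (σ' t) (μ t) (ν t)) ∧
      WeaklyContinuousFamily σ' ∧ ∀ t ∈ U, ∫⁻ z, ENNReal.ofReal (F (z.1, z.2, t)) ∂(σ' t) ≤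
        kantorovichCost (fun x y => F (x, y, t)) (μ t) (ν t) + ENNReal.ofReal ε := by
  have hM0 : 0 ≤ M := by
    have := nonempty_of_isProbabilityMeasure ((μ t₀).prod (ν t₀))
    obtain ⟨z⟩ := this
    exact (hF0 (z.1, z.2, t₀)).trans (hFM _)
  obtain ⟨η, hη⟩ : ∃ η, η = ε / (3 * (2 + 9 * M)) := ⟨_, rfl⟩
  have hηpos : 0 < η := by rw [hη]; positivity
  have hηe : 2 * η + M * (2 * η + 2 * η) + M * (η + 2 * η + 2 * η) = ε / 3 := by
    rw [hη]; field_simp; ring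
  obtain ⟨r, s, φ, ψ, lo, hi, ⟨hφc, hφ0, hφ1, hφn⟩, ⟨hψc, hψ0, hψ1, hψn⟩, hlo0, hhi0, hhiM, hM,
    h2η, hev⟩ := aux_cells (μ t₀) (ν t₀) F hF M hF0 hFM t₀ η hηpos
  have hpc : ∀ i, Continuous fun t => ∫ x, φ i x ∂(μ t) := fun i =>
    aux_wc μ hμc (φ i) (hφc i) 1 (aux_le_one φ hφ0 hφ1 i)
  have hqc : ∀ i, Continuous fun t => ∫ x, ψ i x ∂(ν t) := fun i =>
    aux_wc ν hνc (ψ i) (hψc i) 1 (aux_le_one ψ hψ0 hψ1 i)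
  have n1 : ∀ᶠ t in 𝓝 t₀, ∫ x, φ none x ∂(μ t) < 2 * η :=
    (hpc none).continuousAt.eventually_lt continuousAt_const (by linarith)
  have n2 : ∀ᶠ t in 𝓝 t₀, ∫ x, ψ none x ∂(ν t) < 2 * η :=
    (hqc none).continuousAt.eventually_lt continuousAt_const (by linarith)
  have n3 : ∀ᶠ t in 𝓝 t₀, ∑ i, |∫ x, φ i x ∂(μ t) - ∫ x, φ i x ∂(μ t₀)| < η := by
    have : Continuous fun t => ∑ i, |∫ x, φ i x ∂(μ t) - ∫ x, φ i x ∂(μ t₀)| :=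
      continuous_finsetSum _ fun i _ => ((hpc i).sub continuous_const).abs
    exact this.continuousAt.eventually_lt continuousAt_const (by simpa using hηpos)
  have n4 : ∀ᶠ t in 𝓝 t₀, ∑ i, |∫ x, ψ i x ∂(ν t) - ∫ x, ψ i x ∂(ν t₀)| < η := by
    have : Continuous fun t => ∑ i, |∫ x, ψ i x ∂(ν t) - ∫ x, ψ i x ∂(ν t₀)| :=
      continuous_finsetSum _ fun i _ => ((hqc i).sub continuous_const).abs
    exact this.continuousAt.eventually_lt continuousAt_const (by simpa using hηpos)
  have hall := hev.and (n1.and (n2.and (n3.and n4)))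
  have tri : ∀ {J : Type _} [Fintype J] (a b c : J → ℝ), ∑ i, |a i - c i| < η →
      ∑ i, |b i - c i| < η → ∑ i, |a i - b i| ≤ 2 * η := by
    intro J _ a b c h1 h2
    have : ∑ i, |a i - b i| ≤ ∑ i, (|a i - c i| + |b i - c i|) :=
      Finset.sum_le_sum fun i _ => by
        rw [abs_sub_comm (b i)]; exact abs_sub_le _ _ _
    rw [Finset.sum_add_distrib] at this
    linarith
  have tri' : ∀ {J : Type _} [Fintype J] (a b c : J → ℝ), ∑ i, |a i - c i| < η →
      ∑ i, |b i - c i| < η → ∑ i, |a i - b i| ≤ 2 * η := by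
    intro J _ a b c h1 h2
    have : ∑ i, |a i - b i| ≤ ∑ i, (|a i - c i| + |b i - c i|) :=
      Finset.sum_le_sum fun i _ => by
        rw [abs_sub_comm (b i)]; exact abs_sub_le _ _ _
    rw [Finset.sum_add_distrib] at this
    linarith
  obtain ⟨U, hU, hUall⟩ := hall.exists_mem
  have ht₀U : t₀ ∈ U := mem_of_mem_nhds hU
  have TR : ∀ t₁ ∈ U, ∀ σ, IsCoupling σ (μ t₁) (ν t₁) →
      ∃ σ' : T → Measure (X × Y), (∀ t, IsCoupling (σ' t) (μ t) (ν t)) ∧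
      WeaklyContinuousFamily σ' ∧ ∀ t ∈ U, ∫⁻ z, ENNReal.ofReal (F (z.1, z.2, t)) ∂(σ' t) ≤
        ∫⁻ z, ENNReal.ofReal (F (z.1, z.2, t₁)) ∂σ + ENNReal.ofReal (ε / 3) := by
    intro t₁ ht₁ σ hσ
    obtain ⟨a1, a2, a3, a4, a5⟩ := hUall t₁ ht₁
    obtain ⟨σ', h1, h2, h3⟩ := aux_transfer μ ν hμp hνp hμr hνr hμc hνc φ ψ hφc hφ0 hφ1 hψc hψ0
      hψ1 lo hi M η hηpos.le hM0 hlo0 hhi0 hhiM hM h2η (min 1 η) (lt_min one_pos hηpos)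
      (min_le_left _ _) t₁ σ hσ (fun z => F (z.1, z.2, t₁))
      (fun i j x y hx hy => (a1 i j x y hx hy).1)
    refine ⟨σ', h1, h2, fun t ht => ?_⟩
    obtain ⟨b1, b2, b3, b4, b5⟩ := hUall t ht
    refine (h3 t (fun z => F (z.1, z.2, t)) (fun i j x y hx hy => (b1 i j x y hx hy).2)).trans
      (add_le_add le_rfl (ENNReal.ofReal_le_ofReal ?_))
    rw [← hηe]
    have q1 := tri _ _ _ a4 b4
    have q2 := tri' _ _ _ a5 b5
    have q3 : min 1 η ≤ η := min_le_right _ _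
    gcongr
  have hK : ∀ t ∈ U, kantorovichCost (fun x y => F (x, y, t₀)) (μ t₀) (ν t₀) ≤
      kantorovichCost (fun x y => F (x, y, t)) (μ t) (ν t) + ENNReal.ofReal (ε / 3) := by
    intro t ht
    rw [← tsub_le_iff_right]
    refine le_iInf₂ fun σ hσ => ?_
    rw [tsub_le_iff_right]
    obtain ⟨σ', h1, -, h3⟩ := TR t ht σ hσ
    exact (iInf₂_le (σ' t₀) (h1 t₀)).trans (h3 t₀ ht₀U)
  have hfin : kantorovichCost (fun x y => F (x, y, t₀)) (μ t₀) (ν t₀) < ⊤ := by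
    refine (iInf₂_le ((μ t₀).prod (ν t₀)) (aux_prod_coupling (μ t₀) (ν t₀))).trans_lt ?_
    calc _ ≤ ∫⁻ _, ENNReal.ofReal M ∂((μ t₀).prod (ν t₀)) :=
          lintegral_mono fun z => ENNReal.ofReal_le_ofReal (hFM _)
      _ < ⊤ := by simp
  have hex : ∃ σ, IsCoupling σ (μ t₀) (ν t₀) ∧ ∫⁻ z, ENNReal.ofReal (F (z.1, z.2, t₀)) ∂σ <
      kantorovichCost (fun x y => F (x, y, t₀)) (μ t₀) (ν t₀) + ENNReal.ofReal (ε / 3) := by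
    have := ENNReal.lt_add_right hfin.ne (ENNReal.ofReal_pos.2 (by linarith : 0 < ε / 3)).ne'
    conv_lhs at this => unfold kantorovichCost
    simp only [iInf_lt_iff] at this
    obtain ⟨σ, hσ, h⟩ := this
    exact ⟨σ, hσ, h⟩
  obtain ⟨σ, hσ, hσK⟩ := hex
  obtain ⟨σ', h1, h2, h3⟩ := TR t₀ ht₀U σ hσ
  refine ⟨U, hU, σ', h1, h2, fun t ht => ?_⟩
  have e3 : ENNReal.ofReal ε =
      ENNReal.ofReal (ε / 3) + ENNReal.ofReal (ε / 3) + ENNReal.ofReal (ε / 3) := by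
    rw [← ENNReal.ofReal_add (by positivity) (by positivity),
      ← ENNReal.ofReal_add (by positivity) (by positivity)]
    congr 1; ring
  calc _ ≤ _ := h3 t ht
    _ ≤ (kantorovichCost (fun x y => F (x, y, t₀)) (μ t₀) (ν t₀) + ENNReal.ofReal (ε / 3)) +
        ENNReal.ofReal (ε / 3) := add_le_add hσK.le le_rfl
    _ ≤ ((kantorovichCost (fun x y => F (x, y, t)) (μ t) (ν t) + ENNReal.ofReal (ε / 3)) +
        ENNReal.ofReal (ε / 3)) + ENNReal.ofReal (ε / 3) :=
          add_le_add (add_le_add (hK t ht) le_rfl) le_rfl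
    _ = _ := by rw [e3]; simp only [add_assoc]

theorem aux_coupling_convex {X Y : Type*} [MeasurableSpace X] [MeasurableSpace Y]
    (μ : Measure X) (ν : Measure Y) (σ₁ σ₂ : Measure (X × Y))
    (h₁ : IsCoupling σ₁ μ ν) (h₂ : IsCoupling σ₂ μ ν) (c d : ENNReal) (hcd : c + d = 1) :
    IsCoupling (c • σ₁ + d • σ₂) μ ν := by
  constructor
  · rw [Measure.map_add _ _ measurable_fst, Measure.map_smul, Measure.map_smul, h₁.1, h₂.1,
      ← add_smul, hcd, one_smul]
  · rw [Measure.map_add _ _ measurable_snd, Measure.map_smul, Measure.map_smul, h₁.2, h₂.2,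
      ← add_smul, hcd, one_smul]
/-- If the marginals `μ t`, `ν t` (Radon probability measures on complete
metric spaces) depend weakly continuously on a parameter `t` from a metric space, the cost
`h` is continuous and nonnegative and satisfies the uniform integrability bound
`h(x,y,t) ≤ a_t(x) + b_t(y)` with
`lim_{R→∞} sup_t (∫_{a_t ≥ R} a_t dμ_t + ∫_{b_t ≥ R} b_t dν_t) = 0`,
then for every `ε > 0` one can select `ε`-optimal measures `σ t ∈ Π(μ t, ν t)` for the
cost functions `h_t` continuously depending on `t` in the weak topology. -/
theorem approx_optimal_plans_continuous
    {X Y T : Type*} [MetricSpace X] [CompleteSpace X] [MetricSpace Y] [CompleteSpace Y]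
    [MetricSpace T] [MeasurableSpace X] [BorelSpace X] [MeasurableSpace Y] [BorelSpace Y]
    (μ : T → Measure X) (ν : T → Measure Y)
    (hμp : ∀ t, IsProbabilityMeasure (μ t)) (hνp : ∀ t, IsProbabilityMeasure (ν t))
    (hμr : ∀ t, (μ t).InnerRegular) (hνr : ∀ t, (ν t).InnerRegular)
    (hμc : WeaklyContinuousFamily μ) (hνc : WeaklyContinuousFamily ν)
    (h : X → Y → T → ℝ)
    (hcont : Continuous fun p : X × Y × T => h p.1 p.2.1 p.2.2)
    (hnonneg : ∀ x y t, 0 ≤ h x y t)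
    (a : T → X → ℝ) (b : T → Y → ℝ)
    (hameas : ∀ t, Measurable (a t)) (hbmeas : ∀ t, Measurable (b t))
    (ha0 : ∀ t x, 0 ≤ a t x) (hb0 : ∀ t y, 0 ≤ b t y)
    (haint : ∀ t, Integrable (a t) (μ t)) (hbint : ∀ t, Integrable (b t) (ν t))
    (hdom : ∀ t x y, h x y t ≤ a t x + b t y)
    (hunif : ∀ ε > (0 : ℝ), ∃ R₀ : ℝ, ∀ R ≥ R₀, ∀ t : T,
      (∫ x in {x | R ≤ a t x}, a t x ∂(μ t)) + ∫ y in {y | R ≤ b t y}, b t y ∂(ν t) ≤ ε)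
    (ε : ℝ) (hε : 0 < ε) :
    ∃ σ : T → Measure (X × Y),
      (∀ t, IsCoupling (σ t) (μ t) (ν t)) ∧
      (∀ t, (∫⁻ p, ENNReal.ofReal (h p.1 p.2 t) ∂(σ t)) ≤
        kantorovichCost (fun x y => h x y t) (μ t) (ν t) + ENNReal.ofReal ε) ∧
      WeaklyContinuousFamily σ := by
  have hε2 : 0 < ε / 2 := by linarith
  obtain ⟨R₀, hR₀⟩ := hunif (ε / 2) hε2
  obtain ⟨R, hRdef⟩ : ∃ R, R = max R₀ 0 := ⟨_, rfl⟩
  have hR0 : 0 ≤ R := hRdef ▸ le_max_right _ _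
  have hR := hR₀ R (hRdef ▸ le_max_left _ _)
  let F : X × Y × T → ℝ := fun p => min (h p.1 p.2.1 p.2.2) (2 * R)
  have hFc : Continuous F := hcont.min continuous_const
  -- truncation
  have htr : ∀ t σ, IsCoupling σ (μ t) (ν t) → ∫⁻ p, ENNReal.ofReal (h p.1 p.2 t) ∂σ ≤
      ∫⁻ p, ENNReal.ofReal (F (p.1, p.2, t)) ∂σ + ENNReal.ofReal (ε / 2) := by
    intro t σ hσ
    have mA : MeasurableSet {x | R ≤ a t x} := measurableSet_le measurable_const (hameas t)
    have mB : MeasurableSet {y | R ≤ b t y} := measurableSet_le measurable_const (hbmeas t)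
    let A : X → ℝ := {x | R ≤ a t x}.indicator (a t)
    let B : Y → ℝ := {y | R ≤ b t y}.indicator (b t)
    have hA0 : ∀ x, 0 ≤ A x := fun x => Set.indicator_nonneg (fun x _ => ha0 t x) x
    have hB0 : ∀ x, 0 ≤ B x := fun x => Set.indicator_nonneg (fun x _ => hb0 t x) x
    have hAm : Measurable A := (hameas t).indicator mA
    have hBm : Measurable B := (hbmeas t).indicator mB
    have hpt : ∀ p : X × Y, h p.1 p.2 t ≤ F (p.1, p.2, t) + (A p.1 + B p.2) := by
      intro p
      have h1 := hdom t p.1 p.2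
      have hA1 : a t p.1 ≤ R + A p.1 := by
        by_cases hx : R ≤ a t p.1
        · have : A p.1 = a t p.1 := Set.indicator_of_mem (s := {x | R ≤ a t x}) hx _
          linarith
        · linarith [hA0 p.1]
      have hB1 : b t p.2 ≤ R + B p.2 := by
        by_cases hx : R ≤ b t p.2
        · have : B p.2 = b t p.2 := Set.indicator_of_mem (s := {x | R ≤ b t x}) hx _
          linarith
        · linarith [hB0 p.2]
      have h2 : F (p.1, p.2, t) = min (h p.1 p.2 t) (2 * R) := rfl
      rcases min_choice (h p.1 p.2 t) (2 * R) with h3 | h3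
      · rw [h2, h3]; linarith [hA0 p.1, hB0 p.2]
      · rw [h2, h3]; linarith
    calc _ ≤ ∫⁻ p, (ENNReal.ofReal (F (p.1, p.2, t)) +
          (ENNReal.ofReal (A p.1) + ENNReal.ofReal (B p.2))) ∂σ := by
          refine lintegral_mono fun p => ?_
          refine (ENNReal.ofReal_le_ofReal (hpt p)).trans (ENNReal.ofReal_add_le.trans ?_)
          exact add_le_add le_rfl ENNReal.ofReal_add_le
      _ = ∫⁻ p, ENNReal.ofReal (F (p.1, p.2, t)) ∂σ +
          (∫⁻ p, ENNReal.ofReal (A p.1) ∂σ + ∫⁻ p, ENNReal.ofReal (B p.2) ∂σ) := by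
          rw [lintegral_add_right, lintegral_add_right]
          · exact (hBm.comp measurable_snd).ennreal_ofReal
          · exact (hAm.comp measurable_fst).ennreal_ofReal.add
              (hBm.comp measurable_snd).ennreal_ofReal
      _ ≤ _ := by
          refine add_le_add le_rfl ?_
          have eA : ∫⁻ p, ENNReal.ofReal (A p.1) ∂σ =
              ENNReal.ofReal (∫ x in {x | R ≤ a t x}, a t x ∂(μ t)) := by
            rw [← integral_indicator mA, ofReal_integral_eq_lintegral_ofReal
              ((haint t).indicator mA) (Eventually.of_forall hA0), ← hσ.1,
              lintegral_map hAm.ennreal_ofReal measurable_fst]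
          have eB : ∫⁻ p, ENNReal.ofReal (B p.2) ∂σ =
              ENNReal.ofReal (∫ x in {x | R ≤ b t x}, b t x ∂(ν t)) := by
            rw [← integral_indicator mB, ofReal_integral_eq_lintegral_ofReal
              ((hbint t).indicator mB) (Eventually.of_forall hB0), ← hσ.2,
              lintegral_map hBm.ennreal_ofReal measurable_snd]
          rw [eA, eB, ← ENNReal.ofReal_add (setIntegral_nonneg mA fun x _ => ha0 t x)
            (setIntegral_nonneg mB fun x _ => hb0 t x)]
          exact ENNReal.ofReal_le_ofReal (hR t)
  have hKle : ∀ t, kantorovichCost (fun x y => F (x, y, t)) (μ t) (ν t) ≤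
      kantorovichCost (fun x y => h x y t) (μ t) (ν t) := fun t =>
    iInf₂_mono fun σ _ => lintegral_mono fun p => ENNReal.ofReal_le_ofReal (min_le_left _ _)
  let S : T → Set (BoundedContinuousFunction (X × Y) ℝ → ℝ) := fun t =>
    {L | ∃ σ : Measure (X × Y), IsCoupling σ (μ t) (ν t) ∧
      ∫⁻ p, ENNReal.ofReal (h p.1 p.2 t) ∂σ ≤
        kantorovichCost (fun x y => h x y t) (μ t) (ν t) + ENNReal.ofReal ε ∧
      ∀ f, L f = ∫ z, f z ∂σ}
  have hconv : ∀ t, Convex ℝ (S t) := by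
    rintro t L₁ ⟨σ₁, c₁, k₁, e₁⟩ L₂ ⟨σ₂, c₂, k₂, e₂⟩ u v hu hv huv
    have huv' : ENNReal.ofReal u + ENNReal.ofReal v = 1 := by
      rw [← ENNReal.ofReal_add hu hv, huv, ENNReal.ofReal_one]
    refine ⟨ENNReal.ofReal u • σ₁ + ENNReal.ofReal v • σ₂,
      aux_coupling_convex _ _ _ _ c₁ c₂ _ _ huv', ?_, ?_⟩
    · rw [lintegral_add_measure, lintegral_smul_measure, lintegral_smul_measure]
      simp only [smul_eq_mul]
      refine (add_le_add (mul_le_mul_right k₁ _) (mul_le_mul_right k₂ _)).trans ?_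
      rw [← add_mul, huv', one_mul]
    · intro f
      have i₁ := aux_integrable (μ t) (ν t) σ₁ c₁ f f.continuous ‖f‖ f.norm_coe_le_norm
      have i₂ := aux_integrable (μ t) (ν t) σ₂ c₂ f f.continuous ‖f‖ f.norm_coe_le_norm
      rw [integral_add_measure (i₁.smul_measure ENNReal.ofReal_ne_top)
        (i₂.smul_measure ENNReal.ofReal_ne_top), integral_smul_measure, integral_smul_measure,
        ENNReal.toReal_ofReal hu, ENNReal.toReal_ofReal hv, ← e₁, ← e₂]
      rfl
  obtain ⟨g, hg⟩ := exists_continuous_forall_mem_convex_of_local hconv (by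
    intro t₀
    obtain ⟨U, hU, σ, h1, h2, h3⟩ := aux_local μ ν hμp hνp hμr hνr hμc hνc F hFc (2 * R)
      (fun p => le_min (hnonneg _ _ _) (by linarith)) (fun p => min_le_right _ _) t₀ (ε / 2) hε2
    refine ⟨U, hU, fun t f => ∫ z, f z ∂(σ t), (continuous_pi fun f => h2 f).continuousOn, ?_⟩
    intro t ht
    refine ⟨σ t, h1 t, ?_, fun f => rfl⟩
    calc _ ≤ _ := htr t (σ t) (h1 t)
      _ ≤ _ := add_le_add (h3 t ht) le_rfl
      _ ≤ (kantorovichCost (fun x y => h x y t) (μ t) (ν t) + ENNReal.ofReal (ε / 2)) +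
          ENNReal.ofReal (ε / 2) := add_le_add (add_le_add (hKle t) le_rfl) le_rfl
      _ = _ := by
        rw [add_assoc, ← ENNReal.ofReal_add hε2.le hε2.le, add_halves])
  choose σ hσ using hg
  refine ⟨σ, fun t => (hσ t).1, fun t => (hσ t).2.1, fun f => ?_⟩
  have : (fun t => ∫ x, f x ∂(σ t)) = fun t => g t f := by
    funext t
    exact ((hσ t).2.2 f).symm
  rw [this]
  exact (continuous_apply f).comp g.continuous
end
end

section
/- Let X and Y be complete metric spaces and T a metric space. For every t ∈ T let μ_t ∈ P_r(X) and ν_t ∈ P_r(Y) be such that the mappings t ↦ μ_t and t ↦ ν_t are continuous in the weak topology. Let h : X × Y × T → [0,∞) be continuous, and suppose that for every t there exist nonnegative Borel functions a_t ∈ L¹(μ_t) and b_t ∈ L¹(ν_t) such that h(x,y,t) ≤ a_t(x) + b_t(y) and lim_{R→+∞} sup_t ( ∫_{{a_t ≥ R}} a_t dμ_t + ∫_{{b_t ≥ R}} b_t dν_t ) = 0. If for every t ∈ T there is a unique measure σ_t ∈ Π(μ_t, ν_t) with ∫ h_t dσ_t = K_{h_t}(μ_t, ν_t), then the mapping t ↦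 σ_t is continuous in the weak topology. -/
open MeasureTheory Filter Topology

noncomputable section

lemma aux_extend {X Y : Type*} [MeasurableSpace X] [MeasurableSpace Y]
    (μ : Measure X) (ν : Measure Y) [IsProbabilityMeasure μ] [IsProbabilityMeasure ν]
    (τ : Measure (X × Y)) (h1 : τ.map Prod.fst ≤ μ) (h2 : τ.map Prod.snd ≤ ν) :
    ∃ σ : Measure (X × Y), IsCoupling σ μ ν ∧ τ ≤ σ := by
  have m1 : τ.map Prod.fst Set.univ = τ Set.univ := by
    rw [Measure.map_apply measurable_fst MeasurableSet.univ]; simp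
  have m2 : τ.map Prod.snd Set.univ = τ Set.univ := by
    rw [Measure.map_apply measurable_snd MeasurableSet.univ]; simp
  have hle : τ Set.univ ≤ 1 := by
    rw [← m1]; exact (h1 Set.univ).trans (by simp)
  have : IsFiniteMeasure τ := ⟨hle.trans_lt ENNReal.one_lt_top⟩
  set τ1 := τ.map Prod.fst with hτ1
  set τ2 := τ.map Prod.snd with hτ2
  have : IsFiniteMeasure (μ - τ1) := inferInstance
  have : IsFiniteMeasure (ν - τ2) := inferInstance
  have u1 : (μ - τ1) Set.univ = 1 - τ Set.univ := by
    rw [Measure.sub_apply MeasurableSet.univ h1, m1]; simp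
  have u2 : (ν - τ2) Set.univ = 1 - τ Set.univ := by
    rw [Measure.sub_apply MeasurableSet.univ h2, m2]; simp
  have key : ∀ {Z : Type _} [MeasurableSpace Z] (ρ : Measure Z),
      ρ Set.univ = 1 - τ Set.univ →
      (1 - τ Set.univ)⁻¹ • (1 - τ Set.univ) • ρ = ρ := by
    intro Z _ ρ hρ
    by_cases h0 : 1 - τ Set.univ = 0
    · have : ρ = 0 := by rw [← Measure.measure_univ_eq_zero, hρ, h0]
      simp [this]
    · rw [smul_smul, ENNReal.inv_mul_cancel h0 (by finiteness), one_smul]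
  have key' : ∀ {Z : Type _} [MeasurableSpace Z] (ρ : Measure Z),
      ρ Set.univ = 1 - τ Set.univ →
      (1 - τ Set.univ)⁻¹ • (1 - τ Set.univ) • ρ = ρ := by
    intro Z _ ρ hρ
    by_cases h0 : 1 - τ Set.univ = 0
    · have : ρ = 0 := by rw [← Measure.measure_univ_eq_zero, hρ, h0]
      simp [this]
    · rw [smul_smul, ENNReal.inv_mul_cancel h0 (by finiteness), one_smul]
  refine ⟨τ + (1 - τ Set.univ)⁻¹ • ((μ - τ1).prod (ν - τ2)), ⟨?_, ?_⟩, Measure.le_add_right le_rfl⟩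
  · rw [Measure.map_add _ _ measurable_fst, Measure.map_smul, Measure.map_fst_prod, u2, key _ u1,
      add_comm, Measure.sub_add_cancel_of_le h1]
  · rw [Measure.map_add _ _ measurable_snd, Measure.map_smul, Measure.map_snd_prod, u1, key' _ u2,
      add_comm, Measure.sub_add_cancel_of_le h2]

lemma aux_pou {X : Type*} [MetricSpace X] {K : Set X} (hK : IsCompact K) {ε : ℝ} (hε : 0 < ε) :
    ∃ (s : Finset X) (φ : s → BoundedContinuousFunction X NNReal),
      (∀ x, ∑ i, φ i x ≤ 1) ∧ (∀ x ∈ K, ∑ i, φ i x = 1) ∧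
      ∀ i x y, φ i x ≠ 0 → φ i y ≠ 0 → dist x y < ε := by
  obtain ⟨s, hs⟩ := hK.elim_finite_subcover (fun x : X => Metric.ball x (ε/2))
    (fun _ => Metric.isOpen_ball) (fun x _ => Set.mem_iUnion.2 ⟨x, Metric.mem_ball_self (half_pos hε)⟩)
  obtain ⟨f, hf⟩ := PartitionOfUnity.exists_isSubordinate hK.isClosed
    (fun x : s => Metric.ball (x : X) (ε/2)) (fun _ => Metric.isOpen_ball)
    (by intro x hx; simpa using hs hx)
  have hsum : ∀ x, ((∑ i, (f i x).toNNReal : NNReal) : ℝ) = ∑ᶠ i, f i x := by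
    intro x
    rw [finsum_eq_sum_of_fintype]
    push_cast
    exact Finset.sum_congr rfl fun i _ => Real.coe_toNNReal _ (f.nonneg i x)
  refine ⟨s, fun i => BoundedContinuousFunction.mkOfBound
    ⟨fun x => (f i x).toNNReal, by fun_prop⟩ 2 ?_, ?_, ?_, ?_⟩
  · intro x y
    have a1 := f.le_one i x
    have a2 := f.le_one i y
    have b1 := f.nonneg i x
    have b2 := f.nonneg i y
    simp only [ContinuousMap.coe_mk, NNReal.dist_eq, Real.coe_toNNReal _ b1, Real.coe_toNNReal _ b2]
    rw [abs_le]; constructor <;> linarith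
  · intro x
    have := f.sum_le_one x
    rw [← hsum] at this
    exact_mod_cast this
  · intro x hx
    have := f.sum_eq_one hx
    rw [← hsum] at this
    exact_mod_cast this
  · intro i x y hx hy
    have : ∀ z, (f i z).toNNReal ≠ 0 → dist z i < ε/2 := by
      intro z hz
      have : f i z ≠ 0 := by intro h; simp [h] at hz
      exact Metric.mem_ball.1 (hf i (subset_tsupport _ this))
    have h1 := this x hx
    have h2 := this y hy
    have := dist_triangle_right x y i
    linarith
open scoped ENNReal in
lemma aux_marg {ι κ X : Type*} [Fintype ι] [Fintype κ] [MeasurableSpace X]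
    (μ' : Measure X) (φ : ι → X → NNReal) (hφm : ∀ i, Measurable (φ i)) (hφ : ∀ x, ∑ i, φ i x ≤ 1)
    (c : ℝ≥0∞) (w : ι → κ → ℝ≥0∞) (p : ι → ℝ≥0∞) (q' : κ → ℝ≥0∞)
    (hw : ∀ i, ∑ j, w i j ≤ p i) (hc : ∀ i, c * p i ≤ ∫⁻ x, φ i x ∂μ') 
    (A : Set X) :
    ∑ i, ∑ j, (c * w i j * (∫⁻ x, φ i x ∂μ')⁻¹ * (q' j)⁻¹) *
      ((∫⁻ x in A, φ i x ∂μ') * q' j) ≤ μ' A := by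
  calc _ ≤ ∑ i, ∫⁻ x in A, φ i x ∂μ' := by
        refine Finset.sum_le_sum fun i _ => ?_
        calc _ ≤ ∑ j, (c * w i j * (∫⁻ x, φ i x ∂μ')⁻¹) * (∫⁻ x in A, φ i x ∂μ') := by
              refine Finset.sum_le_sum fun j _ => ?_
              calc _ = (c * w i j * (∫⁻ x, φ i x ∂μ')⁻¹) * (∫⁻ x in A, φ i x ∂μ') *
                    (q' j * (q' j)⁻¹) := by ring
                _ ≤ _ * 1 := by gcongr; exact ENNReal.mul_inv_le_one _
                _ = _ := mul_one _
          _ = (c * ∑ j, w i j) * (∫⁻ x, φ i x ∂μ')⁻¹ * (∫⁻ x in A, φ i x ∂μ') := by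
              rw [← Finset.sum_mul, ← Finset.sum_mul, ← Finset.mul_sum]
          _ ≤ (∫⁻ x, φ i x ∂μ') * (∫⁻ x, φ i x ∂μ')⁻¹ * (∫⁻ x in A, φ i x ∂μ') := by
              gcongr
              exact (mul_le_mul_right (hw i) c).trans (hc i)
          _ ≤ 1 * _ := by gcongr; exact ENNReal.mul_inv_le_one _
          _ = _ := one_mul _
    _ = ∫⁻ x in A, ∑ i, (φ i x : ℝ≥0∞) ∂μ' := by
        rw [lintegral_finsetSum]
        exact fun i _ => (hφm i).coe_nnreal_ennreal
    _ ≤ ∫⁻ x in A, 1 ∂μ' := by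
        refine lintegral_mono fun x => ?_
        show (∑ i, (φ i x : ℝ≥0∞)) ≤ 1
        exact_mod_cast hφ x
    _ = μ' A := by simp

open scoped ENNReal in
lemma aux_approx {ι κ X Y : Type*} [Fintype ι] [Fintype κ] [MetricSpace X] [MetricSpace Y]
    [SecondCountableTopology X] [SecondCountableTopology Y]
    [MeasurableSpace X] [BorelSpace X] [MeasurableSpace Y] [BorelSpace Y]
    (μ : Measure X) (ν : Measure Y) (σ : Measure (X × Y)) [IsProbabilityMeasure σ]
    (hσ : IsCoupling σ μ ν)
    (μ' : Measure X) (ν' : Measure Y) [IsProbabilityMeasure μ'] [IsProbabilityMeasure ν']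
    (φ : ι → X → NNReal) (ψ : κ → Y → NNReal) (hφm : ∀ i, Measurable (φ i))
    (hψm : ∀ i, Measurable (ψ i)) (hφ : ∀ x, ∑ i, φ i x ≤ 1) (hψ : ∀ x, ∑ i, ψ i x ≤ 1)
    (K : Set X) (L : Set Y) (hK : MeasurableSet K) (hL : MeasurableSet L)
    (hφK : ∀ x ∈ K, ∑ i, φ i x = 1) (hψL : ∀ x ∈ L, ∑ i, ψ i x = 1)
    (ε : ℝ) (hφε : ∀ i x y, φ i x ≠ 0 → φ i y ≠ 0 → dist x y < ε)
    (hψε : ∀ i x y, ψ i x ≠ 0 → ψ i y ≠ 0 → dist x y < ε)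
    (c : ℝ≥0∞) (hc0 : c ≠ 0) (hcφ : ∀ i, c * ∫⁻ x, φ i x ∂μ ≤ ∫⁻ x, φ i x ∂μ')
    (hcψ : ∀ i, c * ∫⁻ x, ψ i x ∂ν ≤ ∫⁻ x, ψ i x ∂ν') :
    ∃ σ' : Measure (X × Y), IsCoupling σ' μ' ν' ∧ ∀ B, MeasurableSet B →
      c * σ (B ∩ K ×ˢ L) ≤ σ' (Metric.thickening ε B) := by
  classical
  set w : ι → κ → ℝ≥0∞ := fun i j => ∫⁻ p, (φ i p.1 : ℝ≥0∞) * ψ j p.2 ∂σ with hw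
  have hmeas : ∀ i j, Measurable fun p : X × Y => (φ i p.1 : ℝ≥0∞) * ψ j p.2 := fun i j =>
    ((hφm i).comp measurable_fst).coe_nnreal_ennreal.mul
      ((hψm j).comp measurable_snd).coe_nnreal_ennreal
  have hw1 : ∀ i, ∑ j, w i j ≤ ∫⁻ x, φ i x ∂μ := by
    intro i
    rw [hw, ← lintegral_finsetSum _ (fun j _ => hmeas i j), ← hσ.1,
      lintegral_map (hφm i).coe_nnreal_ennreal measurable_fst]
    refine lintegral_mono fun p => ?_
    rw [← Finset.mul_sum]
    calc _ ≤ (φ i p.1 : ℝ≥0∞) * 1 := by gcongr; exact_mod_cast hψ p.2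
      _ = _ := mul_one _
  have hw2 : ∀ j, ∑ i, w i j ≤ ∫⁻ x, ψ j x ∂ν := by
    intro j
    rw [hw, ← lintegral_finsetSum _ (fun i _ => hmeas i j), ← hσ.2,
      lintegral_map (hψm j).coe_nnreal_ennreal measurable_snd]
    refine lintegral_mono fun p => ?_
    rw [← Finset.sum_mul]
    calc _ ≤ 1 * (ψ j p.2 : ℝ≥0∞) := by gcongr; exact_mod_cast hφ p.1
      _ = _ := one_mul _
  set p' : ι → ℝ≥0∞ := fun i => ∫⁻ x, φ i x ∂μ' with hp'
  set q' : κ → ℝ≥0∞ := fun j => ∫⁻ x, ψ j x ∂ν' with hq'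
  have bdd : ∀ {Z : Type _} [MeasurableSpace Z] (ρ : Measure Z) [IsProbabilityMeasure ρ] (f : Z → NNReal),
      (∀ z, f z ≤ 1) → ∫⁻ z, (f z : ℝ≥0∞) ∂ρ < ∞ := by
    intro Z _ ρ _ f hf
    refine lt_of_le_of_lt (lintegral_mono (g := fun _ => 1) fun z => ?_) (by simp)
    show (f z : ℝ≥0∞) ≤ 1
    exact_mod_cast hf z
  have bdd' : ∀ {Z : Type _} [MeasurableSpace Z] (ρ : Measure Z) [IsProbabilityMeasure ρ] (f : Z → NNReal),
      (∀ z, f z ≤ 1) → ∫⁻ z, (f z : ℝ≥0∞) ∂ρ < ∞ := by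
    intro Z _ ρ _ f hf
    refine lt_of_le_of_lt (lintegral_mono (g := fun _ => 1) fun z => ?_) (by simp)
    show (f z : ℝ≥0∞) ≤ 1
    exact_mod_cast hf z
  have hp'fin : ∀ i, p' i < ∞ := fun i => bdd μ' _ fun x =>
    (Finset.single_le_sum (f := fun i => φ i x) (fun _ _ => zero_le) (Finset.mem_univ i)).trans (hφ x)
  have hq'fin : ∀ i, q' i < ∞ := fun i => bdd' ν' _ fun x =>
    (Finset.single_le_sum (f := fun i => ψ i x) (fun _ _ => zero_le) (Finset.mem_univ i)).trans (hψ x)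
  let M : ι → Measure X := fun i => μ'.withDensity fun x => φ i x
  let N : κ → Measure Y := fun j => ν'.withDensity fun x => ψ j x
  have hM : ∀ i, M i Set.univ = p' i := fun i => by simp [M, p']
  have hN : ∀ i, N i Set.univ = q' i := fun i => by simp [N, q']
  have : ∀ i, IsFiniteMeasure (M i) := fun i => ⟨by rw [hM]; exact hp'fin i⟩
  have : ∀ i, IsFiniteMeasure (N i) := fun i => ⟨by rw [hN]; exact hq'fin i⟩
  let τ : Measure (X × Y) := ∑ i, ∑ j,
    (c * w i j * (p' i)⁻¹ * (q' j)⁻¹) • ((M i).prod (N j))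
  have hτ : ∀ S, τ S = ∑ i, ∑ j, (c * w i j * (p' i)⁻¹ * (q' j)⁻¹) * ((M i).prod (N j)) S := by
    intro S; simp [τ, Measure.finsetSum_apply]
  have h1 : τ.map Prod.fst ≤ μ' := by
    refine Measure.le_iff.2 fun A hA => ?_
    rw [Measure.map_apply measurable_fst hA, hτ]
    refine le_trans (le_of_eq ?_) (aux_marg μ' φ hφm hφ c w _ q' hw1 hcφ A)
    refine Finset.sum_congr rfl fun i _ => Finset.sum_congr rfl fun j _ => ?_
    rw [← Set.prod_univ, Measure.prod_prod, hN]
    simp [M, withDensity_apply _ hA, p']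
  have h2 : τ.map Prod.snd ≤ ν' := by
    refine Measure.le_iff.2 fun A hA => ?_
    rw [Measure.map_apply measurable_snd hA, hτ, Finset.sum_comm]
    refine le_trans (le_of_eq ?_)
      (aux_marg ν' ψ hψm hψ c (fun j i => w i j) _ p' hw2 hcψ A)
    refine Finset.sum_congr rfl fun j _ => Finset.sum_congr rfl fun i _ => ?_
    rw [← Set.univ_prod, Measure.prod_prod, hM]
    simp only [N, withDensity_apply _ hA, q']
    ring
  obtain ⟨σ', hσ', hle⟩ := aux_extend μ' ν' τ h1 h2
  refine ⟨σ', hσ', fun B hB => le_trans ?_ (hle _)⟩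
  let I : ι → κ → Prop := fun i j => ∃ p ∈ B, φ i p.1 ≠ 0 ∧ ψ j p.2 ≠ 0
  have hcell : ∀ i j, I i j → c * w i j ≤ (c * w i j * (p' i)⁻¹ * (q' j)⁻¹) *
      ((M i).prod (N j)) (Metric.thickening ε B) := by
    rintro i j ⟨p, hpB, hp1, hp2⟩
    have hwi : w i j ≤ ∫⁻ x, φ i x ∂μ := 
      (Finset.single_le_sum (f := fun j => w i j) (fun _ _ => zero_le) (Finset.mem_univ j)).trans (hw1 i)
    have hwj : w i j ≤ ∫⁻ x, ψ j x ∂ν := 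
      (Finset.single_le_sum (f := fun i => w i j) (fun _ _ => zero_le) (Finset.mem_univ i)).trans (hw2 j)
    by_cases hw0 : w i j = 0
    · simp [hw0]
    have hp0 : p' i ≠ 0 := by
      intro h0
      have := (mul_le_mul_right hwi c).trans (hcφ i)
      rw [show ∫⁻ x, (φ i x : ℝ≥0∞) ∂μ' = 0 from h0] at this
      simp [hc0, hw0] at this
    have hq0 : q' j ≠ 0 := by
      intro h0
      have := (mul_le_mul_right hwj c).trans (hcψ j)
      rw [show ∫⁻ x, (ψ j x : ℝ≥0∞) ∂ν' = 0 from h0] at this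
      simp [hc0, hw0] at this
    have hfull : p' i * q' j ≤ ((M i).prod (N j)) (Metric.thickening ε B) := by
      have e1 : M i {x | φ i x ≠ 0} = p' i := by
        rw [← hM]
        refine measure_eq_measure_of_null_sdiff (Set.subset_univ _) ?_
        have hms : MeasurableSet {x | φ i x = 0} := hφm i (measurableSet_singleton 0)
        have : Set.univ \ {x | φ i x ≠ 0} = {x | φ i x = 0} := by ext; simp
        rw [this, withDensity_apply _ hms]
        rw [setLIntegral_congr_fun hms (g := fun _ => 0) (fun x hx => by
          simpa using hx)]
        simp
      have e2 : N j {x | ψ j x ≠ 0} = q' j := by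
        rw [← hN]
        refine measure_eq_measure_of_null_sdiff (Set.subset_univ _) ?_
        have hms : MeasurableSet {x | ψ j x = 0} := hψm j (measurableSet_singleton 0)
        have : Set.univ \ {x | ψ j x ≠ 0} = {x | ψ j x = 0} := by ext; simp
        rw [this, withDensity_apply _ hms]
        rw [setLIntegral_congr_fun hms (g := fun _ => 0) (fun x hx => by
          simpa using hx)]
        simp
      rw [← e1, ← e2, ← Measure.prod_prod]
      refine measure_mono ?_
      rintro ⟨x, y⟩ ⟨hx, hy⟩
      rw [Metric.mem_thickening_iff]
      refine ⟨p, hpB, ?_⟩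
      rw [Prod.dist_eq]
      exact max_lt (hφε i _ _ hx hp1) (hψε j _ _ hy hp2)
    calc c * w i j = c * w i j * ((p' i)⁻¹ * p' i) * ((q' j)⁻¹ * q' j) := by
          rw [ENNReal.inv_mul_cancel hp0 (hp'fin i).ne, ENNReal.inv_mul_cancel hq0 (hq'fin j).ne]
          simp
      _ = (c * w i j * (p' i)⁻¹ * (q' j)⁻¹) * (p' i * q' j) := by ring
      _ ≤ _ := by gcongr
  have hBKL : MeasurableSet (B ∩ K ×ˢ L) := hB.inter (hK.prod hL)
  calc c * σ (B ∩ K ×ˢ L)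
      = c * ∫⁻ p in B ∩ K ×ˢ L, 1 ∂σ := by simp
    _ ≤ c * ∫⁻ p in B ∩ K ×ˢ L, ∑ i, ∑ j, (if I i j then (φ i p.1 : ℝ≥0∞) * ψ j p.2 else 0) ∂σ := by
        gcongr 1
        refine setLIntegral_mono' hBKL fun p hp => le_of_eq ?_
        have e1 : ∑ i, (φ i p.1 : ℝ≥0∞) = 1 := by exact_mod_cast hφK p.1 hp.2.1
        have e2 : ∑ i, (ψ i p.2 : ℝ≥0∞) = 1 := by exact_mod_cast hψL p.2 hp.2.2
        rw [← mul_one (1 : ℝ≥0∞)]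
        nth_rw 1 [← e1]
        rw [← e2, Finset.sum_mul]
        refine Finset.sum_congr rfl fun i _ => ?_
        rw [Finset.mul_sum]
        refine Finset.sum_congr rfl fun j _ => ?_
        split_ifs with hI
        · rfl
        · by_contra hne
          apply hI
          refine ⟨p, hp.1, ?_, ?_⟩
          · intro h0; apply hne; simp [h0]
          · intro h0; apply hne; simp [h0]
    _ ≤ c * ∫⁻ p, ∑ i, ∑ j, (if I i j then (φ i p.1 : ℝ≥0∞) * ψ j p.2 else 0) ∂σ := by
        gcongr 1
        exact setLIntegral_le_lintegral _ _
    _ = ∑ i, ∑ j, (if I i j then c * w i j else 0) := by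
        have hm : ∀ i j, Measurable fun p : X × Y =>
            (if I i j then (φ i p.1 : ℝ≥0∞) * ψ j p.2 else 0) := by
          intro i j; split_ifs
          · exact hmeas i j
          · exact measurable_const
        rw [lintegral_finsetSum _ (fun i _ => Finset.measurable_sum _ fun j _ => hm i j), Finset.mul_sum]
        refine Finset.sum_congr rfl fun i _ => ?_
        rw [lintegral_finsetSum _ (fun j _ => hm i j), Finset.mul_sum]
        refine Finset.sum_congr rfl fun j _ => ?_
        split_ifs <;> simp [w]
    _ ≤ τ (Metric.thickening ε B) := by
        rw [hτ]
        refine Finset.sum_le_sum fun i _ => Finset.sum_le_sum fun j _ => ?_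
        split_ifs with hI
        · exact hcell i j hI
        · exact zero_le
open scoped ENNReal in
lemma aux_coupling_near {X Y : Type*} [MetricSpace X] [MetricSpace Y]
    [CompleteSpace X] [CompleteSpace Y]
    [SecondCountableTopology X] [SecondCountableTopology Y]
    [MeasurableSpace X] [BorelSpace X] [MeasurableSpace Y] [BorelSpace Y]
    (μ : ℕ → ProbabilityMeasure X) (ν : ℕ → ProbabilityMeasure Y)
    (μ0 : ProbabilityMeasure X) (ν0 : ProbabilityMeasure Y) (σ : ProbabilityMeasure (X × Y))
    (hμ : Tendsto μ atTop (𝓝 μ0)) (hν : Tendsto ν atTop (𝓝 ν0))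
    (hσ : IsCoupling (σ : Measure (X × Y)) μ0 ν0) (ε : ℝ) (hε : 0 < ε) :
    ∀ᶠ n in atTop, ∃ π : ProbabilityMeasure (X × Y), IsCoupling (π : Measure (X × Y)) (μ n) (ν n) ∧
      levyProkhorovDist (σ : Measure (X × Y)) π ≤ ε := by
  obtain ⟨δ, hδ0, hδ1, hδε⟩ : ∃ δ : NNReal, 0 < δ ∧ δ < 1 ∧ (3 * δ : ℝ) ≤ ε := by
    refine ⟨min (1/2) (ε/3).toNNReal, lt_min (by norm_num) (by simpa using hε), ?_, ?_⟩
    · exact (min_le_left _ _).trans_lt (NNReal.half_lt_self one_ne_zero)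
    · have : ((min (1/2) (ε/3).toNNReal : NNReal) : ℝ) ≤ ε/3 := by
        calc _ ≤ (((ε/3).toNNReal : NNReal) : ℝ) := by exact_mod_cast min_le_right _ _
          _ = ε/3 := Real.coe_toNNReal _ (by positivity)
      linarith
  have hδ0' : (0 : ℝ≥0∞) < δ := by exact_mod_cast hδ0
  obtain ⟨K, hK, hKm⟩ := isTightMeasureSet_iff_exists_isCompact_measure_compl_le.1
    (isTightMeasureSet_singleton (μ := (μ0 : Measure X))) δ hδ0'
  obtain ⟨L, hL, hLm⟩ := isTightMeasureSet_iff_exists_isCompact_measure_compl_le.1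
    (isTightMeasureSet_singleton (μ := (ν0 : Measure Y))) δ hδ0'
  replace hKm := hKm _ rfl
  replace hLm := hLm _ rfl
  obtain ⟨s, φ, hφ, hφK, hφε⟩ := aux_pou hK hε
  obtain ⟨r, ψ, hψ, hψL, hψε⟩ := aux_pou hL hε
  set c : ℝ≥0∞ := 1 - δ with hc
  have hc1 : c < 1 := ENNReal.sub_lt_self (by simp) (by simp) hδ0'.ne'
  have hc0 : c ≠ 0 := by
    rw [hc]; simpa [tsub_eq_zero_iff_le] using hδ1
  have ev : ∀ {Z : Type _} [MetricSpace Z] [MeasurableSpace Z] [BorelSpace Z]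
      (ρ : ℕ → ProbabilityMeasure Z) (ρ0 : ProbabilityMeasure Z) (_ : Tendsto ρ atTop (𝓝 ρ0))
      (f : BoundedContinuousFunction Z NNReal), ∀ᶠ n in atTop,
        c * ∫⁻ z, f z ∂(ρ0 : Measure Z) ≤ ∫⁻ z, f z ∂(ρ n : Measure Z) := by
    intro Z _ _ _ ρ ρ0 hρ f
    have ht := ProbabilityMeasure.tendsto_iff_forall_lintegral_tendsto.1 hρ f
    by_cases h0 : ∫⁻ z, f z ∂(ρ0 : Measure Z) = 0
    · simp [h0]
    · have hfin : ∫⁻ z, f z ∂(ρ0 : Measure Z) ≠ ∞ :=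
        (f.lintegral_lt_top_of_nnreal (ρ0 : Measure Z)).ne
      have : c * ∫⁻ z, f z ∂(ρ0 : Measure Z) < ∫⁻ z, f z ∂(ρ0 : Measure Z) := by
        calc _ < 1 * ∫⁻ z, f z ∂(ρ0 : Measure Z) := by
              exact (ENNReal.mul_lt_mul_iff_left h0 hfin).2 hc1
          _ = _ := one_mul _
      exact (ht.eventually (lt_mem_nhds this)).mono fun n hn => hn.le
  have ev' : ∀ {Z : Type _} [MetricSpace Z] [MeasurableSpace Z] [BorelSpace Z]
      (ρ : ℕ → ProbabilityMeasure Z) (ρ0 : ProbabilityMeasure Z) (_ : Tendsto ρ atTop (𝓝 ρ0))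
      (f : BoundedContinuousFunction Z NNReal), ∀ᶠ n in atTop,
        c * ∫⁻ z, f z ∂(ρ0 : Measure Z) ≤ ∫⁻ z, f z ∂(ρ n : Measure Z) := by
    intro Z _ _ _ ρ ρ0 hρ f
    have ht := ProbabilityMeasure.tendsto_iff_forall_lintegral_tendsto.1 hρ f
    by_cases h0 : ∫⁻ z, f z ∂(ρ0 : Measure Z) = 0
    · simp [h0]
    · have hfin : ∫⁻ z, f z ∂(ρ0 : Measure Z) ≠ ∞ :=
        (f.lintegral_lt_top_of_nnreal (ρ0 : Measure Z)).ne
      have : c * ∫⁻ z, f z ∂(ρ0 : Measure Z) < ∫⁻ z, f z ∂(ρ0 : Measure Z) := by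
        calc _ < 1 * ∫⁻ z, f z ∂(ρ0 : Measure Z) := by
              exact (ENNReal.mul_lt_mul_iff_left h0 hfin).2 hc1
          _ = _ := one_mul _
      exact (ht.eventually (lt_mem_nhds this)).mono fun n hn => hn.le
  filter_upwards [eventually_all.2 fun i => ev μ μ0 hμ (φ i),
    eventually_all.2 fun j => ev' ν ν0 hν (ψ j)] with n hn1 hn2
  obtain ⟨π, hπ, hπB⟩ := aux_approx (μ0 : Measure X) (ν0 : Measure Y) (σ : Measure (X × Y)) hσ
    (μ n : Measure X) (ν n : Measure Y) (fun i => φ i) (fun j => ψ j)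
    (fun i => (φ i).continuous.measurable) (fun j => (ψ j).continuous.measurable) hφ hψ K L
    hK.measurableSet hL.measurableSet hφK hψL ε hφε hψε c hc0 hn1 hn2
  have hπp : IsProbabilityMeasure π := by
    constructor
    have := congrArg (fun m => m Set.univ) hπ.1
    simpa [Measure.map_apply measurable_fst MeasurableSet.univ] using this
  refine ⟨⟨π, hπp⟩, hπ, ?_⟩
  show levyProkhorovDist (σ : Measure (X × Y)) π ≤ ε
  refine levyProkhorovDist_le_of_forall_le _ _ hε.le fun η B hη hB => ?_
  have hKL : (σ : Measure (X × Y)) (K ×ˢ L)ᶜ ≤ δ + δ := by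
    have e1 : (σ : Measure (X × Y)) (Prod.fst ⁻¹' Kᶜ) ≤ δ := by
      rw [← Measure.map_apply measurable_fst hK.measurableSet.compl, hσ.1]; exact hKm
    have e2 : (σ : Measure (X × Y)) (Prod.snd ⁻¹' Lᶜ) ≤ δ := by
      rw [← Measure.map_apply measurable_snd hL.measurableSet.compl, hσ.2]; exact hLm
    refine le_trans (measure_mono ?_) ((measure_union_le _ _).trans (add_le_add e1 e2))
    rintro ⟨x, y⟩ h
    by_contra h'
    simp_all
  have hs : (σ : Measure (X × Y)) (B ∩ K ×ˢ L) ≤ 1 := prob_le_one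
  calc (σ : Measure (X × Y)) B
      ≤ (σ : Measure (X × Y)) (B ∩ K ×ˢ L) + (σ : Measure (X × Y)) (K ×ˢ L)ᶜ := by
        refine le_trans (measure_mono ?_) (measure_union_le _ _)
        intro z hz
        by_cases h : z ∈ K ×ˢ L
        · exact Or.inl ⟨hz, h⟩
        · exact Or.inr h
    _ ≤ (c * (σ : Measure (X × Y)) (B ∩ K ×ˢ L) + δ) + (δ + δ) := by
        gcongr
        calc (σ : Measure (X × Y)) (B ∩ K ×ˢ L) = (c + δ) * (σ : Measure (X × Y)) (B ∩ K ×ˢ L) := by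
              rw [hc, tsub_add_cancel_of_le (by exact_mod_cast hδ1.le), one_mul]
          _ = c * (σ : Measure (X × Y)) (B ∩ K ×ˢ L) + δ * (σ : Measure (X × Y)) (B ∩ K ×ˢ L) := add_mul _ _ _
          _ ≤ c * (σ : Measure (X × Y)) (B ∩ K ×ˢ L) + δ * 1 := by gcongr
          _ = _ := by rw [mul_one]
    _ ≤ (π (Metric.thickening η B) + δ) + (δ + δ) := by
        gcongr
        exact (hπB B hB).trans (measure_mono (Metric.thickening_mono hη.le _))
    _ ≤ π (Metric.thickening η B) + ENNReal.ofReal η := by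
        rw [add_assoc]
        gcongr
        have : ENNReal.ofReal (3 * δ) ≤ ENNReal.ofReal η := ENNReal.ofReal_le_ofReal (hδε.trans hη.le)
        refine le_trans (le_of_eq ?_) this
        rw [ENNReal.ofReal_mul (by norm_num), ENNReal.ofReal_coe_nnreal]
        norm_num
        ring

lemma aux_coupling_seq {X Y : Type*} [MetricSpace X] [MetricSpace Y]
    [CompleteSpace X] [CompleteSpace Y]
    [SecondCountableTopology X] [SecondCountableTopology Y]
    [MeasurableSpace X] [BorelSpace X] [MeasurableSpace Y] [BorelSpace Y]
    (μ : ℕ → ProbabilityMeasure X) (ν : ℕ → ProbabilityMeasure Y)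
    (μ0 : ProbabilityMeasure X) (ν0 : ProbabilityMeasure Y) (σ : ProbabilityMeasure (X × Y))
    (hμ : Tendsto μ atTop (𝓝 μ0)) (hν : Tendsto ν atTop (𝓝 ν0))
    (hσ : IsCoupling (σ : Measure (X × Y)) μ0 ν0) :
    ∃ (k : ℕ → ℕ) (π : ℕ → ProbabilityMeasure (X × Y)), Tendsto k atTop atTop ∧
      (∀ n, IsCoupling (π n : Measure (X × Y)) (μ (k n)) (ν (k n))) ∧ Tendsto π atTop (𝓝 σ) := by
  have h : ∀ m : ℕ, ∃ n, m ≤ n ∧ ∃ π : ProbabilityMeasure (X × Y),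
      IsCoupling (π : Measure (X × Y)) (μ n) (ν n) ∧
      levyProkhorovDist (σ : Measure (X × Y)) π ≤ 1 / ((m : ℝ) + 1) := fun m =>
    ((eventually_ge_atTop m).and
      (aux_coupling_near μ ν μ0 ν0 σ hμ hν hσ (1 / ((m : ℝ) + 1)) (by positivity))).exists
  choose k hk π hπ hd using h
  refine ⟨k, π, tendsto_atTop_mono hk tendsto_id, hπ, ?_⟩
  rw [LevyProkhorov.probabilityMeasureHomeomorph.isInducing.tendsto_nhds_iff,
    tendsto_iff_dist_tendsto_zero]
  refine squeeze_zero (fun _ => dist_nonneg) (fun m => ?_) tendsto_one_div_add_atTop_nhds_zero_nat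
  rw [dist_comm]
  exact hd m
lemma aux_tight {Z : Type*} [MetricSpace Z] [CompleteSpace Z] [SecondCountableTopology Z]
    [MeasurableSpace Z] [BorelSpace Z] (ρ : ℕ → ProbabilityMeasure Z) (ρ0 : ProbabilityMeasure Z)
    (hρ : Tendsto ρ atTop (𝓝 ρ0)) :
    IsTightMeasureSet {x | ∃ μ ∈ Set.range ρ, ((μ : ProbabilityMeasure Z) : Measure Z) = x} := by
  apply isTightMeasureSet_of_isCompact_closure
  have h := hρ.isCompact_insert_range
  exact h.of_isClosed_subset isClosed_closure
    (closure_minimal (Set.subset_insert _ _) h.isClosed)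

lemma aux_int {Z T : Type*} [MetricSpace Z] [CompleteSpace Z] [SecondCountableTopology Z]
    [MeasurableSpace Z] [BorelSpace Z] [TopologicalSpace T]
    (ρ : ℕ → ProbabilityMeasure Z) (ρ0 : ProbabilityMeasure Z)
    (hρ : Tendsto ρ atTop (𝓝 ρ0)) (G : T → Z → ℝ) (hG : Continuous fun q : T × Z => G q.1 q.2)
    (N : ℝ) (hN : ∀ t z, |G t z| ≤ N) (t : ℕ → T) (t0 : T) (ht : Tendsto t atTop (𝓝 t0)) :
    Tendsto (fun n => ∫ z, G (t n) z ∂(ρ n : Measure Z)) atTop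
      (𝓝 (∫ z, G t0 z ∂(ρ0 : Measure Z))) := by
  have hGt : ∀ t, Continuous (G t) := fun t => hG.comp (by fun_prop : Continuous fun z => (t, z))
  have hN0 : 0 ≤ N := by
    obtain ⟨z⟩ := ρ0.nonempty
    exact (abs_nonneg _).trans (hN t0 z)
  let g0 : BoundedContinuousFunction Z ℝ := BoundedContinuousFunction.ofNormedAddCommGroup
    (G t0) (hGt t0) N (hN t0)
  have h1 : Tendsto (fun n => ∫ z, G t0 z ∂(ρ n : Measure Z)) atTop
      (𝓝 (∫ z, G t0 z ∂(ρ0 : Measure Z))) :=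
    ProbabilityMeasure.tendsto_iff_forall_integral_tendsto.1 hρ g0
  have hint : ∀ t n, Integrable (G t) (ρ n : Measure Z) := fun t n =>
    Integrable.of_bound (hGt t).measurable.aestronglyMeasurable N (ae_of_all _ (hN t))
  suffices h2 : Tendsto (fun n => ∫ z, G (t n) z ∂(ρ n : Measure Z) - ∫ z, G t0 z ∂(ρ n : Measure Z))
      atTop (𝓝 0) by
    simpa using h2.add h1
  have hunif : ∀ K : Set Z, IsCompact K → TendstoUniformlyOn (fun n z => G (t n) z) (G t0) atTop K := by
    let F : C(T, C(Z, ℝ)) := ContinuousMap.curry ⟨fun q : T × Z => G q.1 q.2, hG⟩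
    have : Tendsto (fun n => F (t n)) atTop (𝓝 (F t0)) := (F.continuous.tendsto t0).comp ht
    exact ContinuousMap.tendsto_iff_forall_isCompact_tendstoUniformlyOn.1 this
  rw [Metric.tendsto_atTop']
  intro ε hε
  obtain ⟨δ, hδ, hδε⟩ : ∃ δ : ℝ, 0 < δ ∧ δ + 2 * N * δ < ε := by
    refine ⟨ε / (2 * (1 + 2 * N)), by positivity, ?_⟩
    have : ε / (2 * (1 + 2 * N)) + 2 * N * (ε / (2 * (1 + 2 * N))) = ε / 2 := by
      field_simp
    linarith
  obtain ⟨K, hK, hKm⟩ := isTightMeasureSet_iff_exists_isCompact_measure_compl_le.1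
    (aux_tight ρ ρ0 hρ) (ENNReal.ofReal δ) (by simpa using hδ)
  obtain ⟨n0, hn0⟩ := eventually_atTop.1 (Metric.tendstoUniformlyOn_iff.1 (hunif K hK) δ hδ)
  refine ⟨n0, fun n hn => ?_⟩
  have hKn : (ρ n : Measure Z).real Kᶜ ≤ δ :=
    ENNReal.toReal_le_of_le_ofReal hδ.le (hKm _ ⟨ρ n, ⟨n, rfl⟩, rfl⟩)
  rw [dist_zero_right, ← integral_sub (hint _ _) (hint _ _)]
  refine lt_of_le_of_lt ?_ hδε
  have hbd : ∀ z, ‖G (t n) z - G t0 z‖ ≤ δ + Set.indicator Kᶜ (fun _ => 2 * N) z := by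
    intro z
    by_cases hz : z ∈ K
    · have := hn0 n hn.le z hz
      rw [dist_comm, dist_eq_norm] at this
      simpa [hz] using this.le
    · have e1 := hN (t n) z
      have e2 := hN t0 z
      have := (norm_sub_le (G (t n) z) (G t0 z))
      simp only [Real.norm_eq_abs] at *
      simp [hz]
      linarith
  have hms := hK.measurableSet.compl
  have hi : Integrable (Set.indicator Kᶜ (fun _ => 2 * N)) (ρ n : Measure Z) :=
    (integrable_const _).indicator hms
  calc _ ≤ ∫ z, (δ + Set.indicator Kᶜ (fun _ => 2 * N) z) ∂(ρ n : Measure Z) :=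
        norm_integral_le_of_norm_le ((integrable_const _).add hi) (ae_of_all _ hbd)
    _ = δ + 2 * N * (ρ n : Measure Z).real Kᶜ := by
        rw [integral_add (integrable_const _) hi, integral_indicator hms]
        simp [mul_comm]
    _ ≤ _ := by gcongr

lemma aux_prob {X Y : Type*} [MeasurableSpace X] [MeasurableSpace Y]
    {σ : Measure (X × Y)} {μ : Measure X} {ν : Measure Y} [IsProbabilityMeasure μ]
    (h : IsCoupling σ μ ν) : IsProbabilityMeasure σ := by
  constructor
  have := congrArg (fun m => m Set.univ) h.1
  simpa [Measure.map_apply measurable_fst MeasurableSet.univ] using this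

lemma aux_lint {Z : Type*} [MetricSpace Z] 
    [MeasurableSpace Z] [BorelSpace Z] (ρ : Measure Z) [IsProbabilityMeasure ρ] (g : Z → ℝ)
    (hg : Continuous g) (h0 : ∀ z, 0 ≤ g z) (N : ℝ) (hN : ∀ z, g z ≤ N) :
    ∫⁻ z, ENNReal.ofReal (g z) ∂ρ = ENNReal.ofReal (∫ z, g z ∂ρ) :=
  (ofReal_integral_eq_lintegral_ofReal (Integrable.of_bound hg.measurable.aestronglyMeasurable N
    (ae_of_all _ fun z => by rw [Real.norm_eq_abs, abs_of_nonneg (h0 z)]; exact hN z))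
    (ae_of_all _ h0)).symm

open scoped ENNReal in
lemma aux_main {X Y T : Type*} [MetricSpace X] [MetricSpace Y] [TopologicalSpace T]
    [CompleteSpace X] [CompleteSpace Y]
    [SecondCountableTopology X] [SecondCountableTopology Y]
    [MeasurableSpace X] [BorelSpace X] [MeasurableSpace Y] [BorelSpace Y]
    (μ : ℕ → ProbabilityMeasure X) (ν : ℕ → ProbabilityMeasure Y)
    (μ0 : ProbabilityMeasure X) (ν0 : ProbabilityMeasure Y) 
    (σ : ℕ → ProbabilityMeasure (X × Y)) (σ0 : ProbabilityMeasure (X × Y))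
    (hμ : Tendsto μ atTop (𝓝 μ0)) (hν : Tendsto ν atTop (𝓝 ν0))
    (t : ℕ → T) (t0 : T) (ht : Tendsto t atTop (𝓝 t0))
    (G : T → X × Y → ℝ) (hG : Continuous fun q : T × (X × Y) => G q.1 q.2)
    (hG0 : ∀ t p, 0 ≤ G t p)
    (hUI : ∀ ε : ℝ, 0 < ε → ∃ N : ℝ, 0 ≤ N ∧ ∀ n (π : Measure (X × Y)), IsCoupling π (μ n) (ν n) →
      ∫⁻ p, ENNReal.ofReal (G (t n) p) ∂π ≤
        ∫⁻ p, ENNReal.ofReal (min (G (t n) p) N) ∂π + ENNReal.ofReal ε)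
    (hσ : ∀ n, IsCoupling (σ n : Measure (X × Y)) (μ n) (ν n))
    (hσ0 : IsCoupling (σ0 : Measure (X × Y)) μ0 ν0)
    (hopt : ∀ n (π : Measure (X × Y)), IsCoupling π (μ n) (ν n) →
      ∫⁻ p, ENNReal.ofReal (G (t n) p) ∂(σ n : Measure (X × Y)) ≤ ∫⁻ p, ENNReal.ofReal (G (t n) p) ∂π)
    (huniq : ∀ (π : Measure (X × Y)), IsCoupling π μ0 ν0 →
      ∫⁻ p, ENNReal.ofReal (G t0 p) ∂π ≤ ∫⁻ p, ENNReal.ofReal (G t0 p) ∂(σ0 : Measure (X × Y)) →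
      π = σ0) :
    Tendsto σ atTop (𝓝 σ0) := by
  refine tendsto_of_subseq_tendsto fun ns hns => ?_
  -- tightness and a limit point
  have htight : IsTightMeasureSet
      {x | ∃ μ ∈ Set.range σ, ((μ : ProbabilityMeasure (X × Y)) : Measure (X × Y)) = x} := by
    apply IsTightMeasureSet.prodMk
    · refine (aux_tight μ μ0 hμ).subset ?_
      rintro _ ⟨_, ⟨_, ⟨n, rfl⟩, rfl⟩, rfl⟩
      exact ⟨μ n, ⟨n, rfl⟩, (hσ n).1.symm⟩
    · refine (aux_tight ν ν0 hν).subset ?_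
      rintro _ ⟨_, ⟨_, ⟨n, rfl⟩, rfl⟩, rfl⟩
      exact ⟨ν n, ⟨n, rfl⟩, (hσ n).2.symm⟩
  have hcomp := isCompact_closure_of_isTightMeasureSet htight
  obtain ⟨σ', -, ms, hms, hlim⟩ := hcomp.tendsto_subseq (x := fun n => σ (ns n))
    (fun n => subset_closure ⟨ns n, rfl⟩)
  refine ⟨ms, ?_⟩
  have hnm : Tendsto (fun n => ns (ms n)) atTop atTop := hns.comp hms.tendsto_atTop
  have hσ' : IsCoupling (σ' : Measure (X × Y)) μ0 ν0 := by
    constructor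
    · have h1 := ProbabilityMeasure.tendsto_map_of_tendsto_of_continuous _ _ hlim
        (continuous_fst (X := X) (Y := Y))
      have h2 : Tendsto (fun n => μ (ns (ms n))) atTop (𝓝 μ0) := hμ.comp hnm
      have h1' : Tendsto (fun n => μ (ns (ms n))) atTop
          (𝓝 (σ'.map (continuous_fst (X := X) (Y := Y)).measurable.aemeasurable)) := by
        refine Tendsto.congr (fun n => ?_) h1
        apply ProbabilityMeasure.toMeasure_injective
        exact (hσ (ns (ms n))).1
      have h3 := tendsto_nhds_unique h1' h2
      exact congrArg (fun m : ProbabilityMeasure X => (m : Measure X)) h3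
    · have h1 := ProbabilityMeasure.tendsto_map_of_tendsto_of_continuous _ _ hlim
        (continuous_snd (X := X) (Y := Y))
      have h2 : Tendsto (fun n => ν (ns (ms n))) atTop (𝓝 ν0) := hν.comp hnm
      have h1' : Tendsto (fun n => ν (ns (ms n))) atTop
          (𝓝 (σ'.map (continuous_snd (X := X) (Y := Y)).measurable.aemeasurable)) := by
        refine Tendsto.congr (fun n => ?_) h1
        apply ProbabilityMeasure.toMeasure_injective
        exact (hσ (ns (ms n))).2
      have h3 := tendsto_nhds_unique h1' h2
      exact congrArg (fun m : ProbabilityMeasure Y => (m : Measure Y)) h3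
  obtain ⟨k, π, hk, hπ, hπlim⟩ := aux_coupling_seq (fun n => μ (ns (ms n)))
    (fun n => ν (ns (ms n))) μ0 ν0 σ0 (hμ.comp hnm) (hν.comp hnm) hσ0
  have hall : Tendsto (fun n => ns (ms (k n))) atTop atTop := hnm.comp hk
  have hcut : ∀ N : ℝ, 0 ≤ N → ∀ (ρ : ℕ → ProbabilityMeasure (X × Y)) (ρ0 : ProbabilityMeasure (X × Y)),
      Tendsto ρ atTop (𝓝 ρ0) → Tendsto (fun n => ∫⁻ p, ENNReal.ofReal (min (G (t (ns (ms (k n)))) p) N)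
        ∂(ρ n : Measure (X × Y))) atTop
        (𝓝 (∫⁻ p, ENNReal.ofReal (min (G t0 p) N) ∂(ρ0 : Measure (X × Y)))) := by
    intro N hN ρ ρ0 hρ
    have hc : Continuous fun q : T × (X × Y) => min (G q.1 q.2) N := hG.min continuous_const
    have hc' : ∀ t, Continuous fun p => min (G t p) N := fun t =>
      hc.comp (by fun_prop : Continuous fun z => (t, z))
    have hb : ∀ t p, 0 ≤ min (G t p) N := fun t p => le_min (hG0 t p) hN
    have := aux_int ρ ρ0 hρ (fun t p => min (G t p) N) hc N (fun t p => by
      rw [abs_of_nonneg (hb t p)]; exact min_le_right _ _) _ t0 (ht.comp hall)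
    have h2 := ENNReal.tendsto_ofReal this
    rw [aux_lint _ _ (hc' t0) (hb t0) N fun _ => min_le_right _ _]
    refine h2.congr fun n => ?_
    rw [aux_lint _ _ (hc' _) (hb _) N fun _ => min_le_right _ _]
    rfl
  have hle : ∀ M : ℝ, 0 ≤ M → ∀ ε : ℝ, 0 < ε → 
      ∫⁻ p, ENNReal.ofReal (min (G t0 p) M) ∂(σ' : Measure (X × Y)) ≤
      ∫⁻ p, ENNReal.ofReal (G t0 p) ∂(σ0 : Measure (X × Y)) + ENNReal.ofReal ε := by
    intro M hM ε hε
    obtain ⟨N, hN, hUN⟩ := hUI ε hε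
    have l1 := hcut M hM (fun n => σ (ns (ms (k n)))) σ' (hlim.comp hk)
    have l2 := (hcut N hN π σ0 hπlim).add_const (ENNReal.ofReal ε)
    refine (le_of_tendsto_of_tendsto' l1 l2 fun n => ?_).trans ?_
    · calc _ ≤ ∫⁻ p, ENNReal.ofReal (G (t (ns (ms (k n)))) p) ∂(σ (ns (ms (k n))) : Measure (X × Y)) :=
            lintegral_mono fun p => ENNReal.ofReal_le_ofReal (min_le_left _ _)
        _ ≤ ∫⁻ p, ENNReal.ofReal (G (t (ns (ms (k n)))) p) ∂(π n : Measure (X × Y)) :=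
            hopt _ _ (hπ n)
        _ ≤ _ := hUN _ _ (hπ n)
    · gcongr
      exact min_le_left _ _
  have hfin : ∫⁻ p, ENNReal.ofReal (G t0 p) ∂(σ' : Measure (X × Y)) ≤
      ∫⁻ p, ENNReal.ofReal (G t0 p) ∂(σ0 : Measure (X × Y)) := by
    refine ENNReal.le_of_forall_pos_le_add fun ε hε _ => ?_
    have hGc : Continuous (G t0) := hG.comp (by fun_prop : Continuous fun z => (t0, z))
    have hsup : ∀ p, ENNReal.ofReal (G t0 p) = ⨆ m : ℕ, ENNReal.ofReal (min (G t0 p) m) := by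
      intro p
      apply le_antisymm
      · obtain ⟨m, hm⟩ := exists_nat_ge (G t0 p)
        exact le_iSup_of_le m (by rw [min_eq_left hm])
      · exact iSup_le fun m => ENNReal.ofReal_le_ofReal (min_le_left _ _)
    simp_rw [hsup]
    rw [lintegral_iSup]
    · refine iSup_le fun m => ?_
      have := hle m (Nat.cast_nonneg m) ε (by exact_mod_cast hε)
      simp_rw [hsup, ENNReal.ofReal_coe_nnreal] at this
      simpa only [← hsup] using this
    · intro m
      exact ((hGc.min continuous_const).measurable).ennreal_ofReal
    · intro a b hab p
      exact ENNReal.ofReal_le_ofReal (min_le_min_left _ (by exact_mod_cast hab))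
  have : σ' = σ0 := Subtype.ext (huniq _ hσ' hfin)
  rw [← this]
  exact hlim
lemma aux_support {X : Type*} [MetricSpace X] [MeasurableSpace X] [BorelSpace X]
    (μ : ℕ → Measure X) (hp : ∀ n, IsProbabilityMeasure (μ n)) (hr : ∀ n, (μ n).InnerRegular) :
    ∃ S : Set X, IsClosed S ∧ TopologicalSpace.IsSeparable S ∧ ∀ n, μ n Sᶜ = 0 := by
  have h : ∀ n (m : ℕ), ∃ K : Set X, IsCompact K ∧ μ n Kᶜ ≤ ((m : ENNReal) + 1)⁻¹ := by
    intro n m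
    have := hp n
    have := hr n
    obtain ⟨K, hK, h⟩ := isTightMeasureSet_iff_exists_isCompact_measure_compl_le.1
      (isTightMeasureSet_singleton_of_innerRegular (μ := μ n)) ((m : ENNReal) + 1)⁻¹ (by simp)
    exact ⟨K, hK, h _ rfl⟩
  choose K hK hKm using h
  refine ⟨closure (⋃ n, ⋃ m, K n m), isClosed_closure, ?_, fun n => ?_⟩
  · exact (TopologicalSpace.IsSeparable.iUnion fun n => .iUnion fun m => (hK n m).isSeparable).closure
  · have hle : ∀ m : ℕ, μ n (closure (⋃ n, ⋃ m, K n m))ᶜ ≤ ((m : ENNReal) + 1)⁻¹ := fun m =>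
      (measure_mono (Set.compl_subset_compl.2 ((Set.subset_iUnion_of_subset n
        (Set.subset_iUnion _ m)).trans subset_closure))).trans (hKm n m)
    refine le_antisymm (le_of_forall_gt fun ε hε => ?_) zero_le
    obtain ⟨m, hm⟩ := ENNReal.exists_inv_nat_lt hε.ne'
    refine (hle m).trans_lt (lt_of_le_of_lt ?_ hm)
    exact ENNReal.inv_le_inv.2 (le_self_add)

lemma aux_map_comap {X : Type*} [MeasurableSpace X] (S : Set X) (hS : MeasurableSet S)
    (μ : Measure X) (h : μ Sᶜ = 0) : (μ.comap (Subtype.val : S → X)).map Subtype.val = μ := by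
  rw [(MeasurableEmbedding.subtype_coe hS).map_comap, Subtype.range_coe]
  exact Measure.restrict_eq_self_of_ae_mem (by rw [ae_iff]; exact h)

lemma aux_prob_of_map {X Z : Type*} [MeasurableSpace X] [MeasurableSpace Z] (f : Z → X)
    (hf : Measurable f) (μ : Measure X) (ρ : Measure Z) [IsProbabilityMeasure μ]
    (h : ρ.map f = μ) : IsProbabilityMeasure ρ := by
  constructor
  have := congrArg (fun m => m Set.univ) h
  simpa [Measure.map_apply hf MeasurableSet.univ] using this

lemma aux_weak {X : Type*} [MetricSpace X] [MeasurableSpace X] [BorelSpace X]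
    (S : Set X) (hS : IsClosed S) (μ : ℕ → Measure X) (μ0 : Measure X)
    (ρ : ℕ → ProbabilityMeasure S) (ρ0 : ProbabilityMeasure S)
    (hρ : ∀ n, (ρ n : Measure S).map Subtype.val = μ n) (hρ0 : (ρ0 : Measure S).map Subtype.val = μ0)
    (hμ : ∀ f : BoundedContinuousFunction X ℝ, Tendsto (fun n => ∫ x, f x ∂(μ n)) atTop
      (𝓝 (∫ x, f x ∂μ0))) : Tendsto ρ atTop (𝓝 ρ0) := by
  rw [ProbabilityMeasure.tendsto_iff_forall_integral_tendsto]
  intro f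
  obtain ⟨g, -, hg⟩ := BoundedContinuousFunction.exists_norm_eq_domRestrict_eq_of_closed f hS
  have hme := MeasurableEmbedding.subtype_coe hS.measurableSet
  have := hμ g
  simp only [← hρ, ← hρ0, hme.integral_map] at this
  subst hg
  exact this

lemma aux_UI {X Y : Type*} [MeasurableSpace X] [MeasurableSpace Y] (μ : Measure X) (ν : Measure Y)
    (h : X → Y → ℝ) (a : X → ℝ) (b : Y → ℝ) (ham : Measurable a) (hbm : Measurable b)
    (ha0 : ∀ x, 0 ≤ a x) (hb0 : ∀ y, 0 ≤ b y) (haint : Integrable a μ) (hbint : Integrable b ν)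
    (hdom : ∀ x y, h x y ≤ a x + b y) (R ε : ℝ) (hR : 0 ≤ R) 
    (hε : (∫ x in {x | R ≤ a x}, a x ∂μ) + ∫ y in {y | R ≤ b y}, b y ∂ν ≤ ε)
    (π : Measure (X × Y)) (hπ : IsCoupling π μ ν) :
    ∫⁻ p, ENNReal.ofReal (h p.1 p.2) ∂π ≤
      ∫⁻ p, ENNReal.ofReal (min (h p.1 p.2) (2 * R)) ∂π + ENNReal.ofReal ε := by
  have hA : MeasurableSet {x | R ≤ a x} := measurableSet_le measurable_const ham
  have hB : MeasurableSet {y | R ≤ b y} := measurableSet_le measurable_const hbm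
  have mA : Measurable fun x => ENNReal.ofReal (Set.indicator {x | R ≤ a x} a x) :=
    (ham.indicator hA).ennreal_ofReal
  have mB : Measurable fun x => ENNReal.ofReal (Set.indicator {x | R ≤ b x} b x) :=
    (hbm.indicator hB).ennreal_ofReal
  have key : ∀ p : X × Y, ENNReal.ofReal (h p.1 p.2) ≤
      ENNReal.ofReal (min (h p.1 p.2) (2 * R)) +
      (ENNReal.ofReal (Set.indicator {x | R ≤ a x} a p.1) +
        ENNReal.ofReal (Set.indicator {x | R ≤ b x} b p.2)) := by
    rintro ⟨x, y⟩
    have iA : 0 ≤ Set.indicator {x | R ≤ a x} a x := Set.indicator_nonneg (fun _ _ => ha0 _) _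
    have iB : 0 ≤ Set.indicator {x | R ≤ b x} b y := Set.indicator_nonneg (fun _ _ => hb0 _) _
    rw [← ENNReal.ofReal_add iA iB]
    refine le_trans (ENNReal.ofReal_le_ofReal ?_) ENNReal.ofReal_add_le
    have hd := hdom x y
    show h x y ≤ min (h x y) (2 * R) + _
    rcases le_total (h x y) (2 * R) with h1 | h1
    · rw [min_eq_left h1]; linarith
    · rw [min_eq_right h1]
      have := ha0 x
      have := hb0 y
      by_cases hx : R ≤ a x <;> by_cases hy : R ≤ b y <;> simp [Set.indicator, hx, hy] <;> linarith
  calc _ ≤ ∫⁻ p, (ENNReal.ofReal (min (h p.1 p.2) (2 * R)) +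
      (ENNReal.ofReal (Set.indicator {x | R ≤ a x} a p.1) +
        ENNReal.ofReal (Set.indicator {x | R ≤ b x} b p.2))) ∂π := lintegral_mono key
    _ = ∫⁻ p, ENNReal.ofReal (min (h p.1 p.2) (2 * R)) ∂π +
        (∫⁻ x, ENNReal.ofReal (Set.indicator {x | R ≤ a x} a x) ∂μ +
          ∫⁻ x, ENNReal.ofReal (Set.indicator {x | R ≤ b x} b x) ∂ν) := by
        have mA' : Measurable fun p : X × Y => ENNReal.ofReal (Set.indicator {x | R ≤ a x} a p.1) :=
          mA.comp measurable_fst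
        have mB' : Measurable fun p : X × Y => ENNReal.ofReal (Set.indicator {x | R ≤ b x} b p.2) :=
          mB.comp measurable_snd
        have mAB : Measurable fun p : X × Y => (ENNReal.ofReal (Set.indicator {x | R ≤ a x} a p.1) +
          ENNReal.ofReal (Set.indicator {x | R ≤ b x} b p.2)) := mA'.add mB'
        rw [lintegral_add_right _ mAB, lintegral_add_right _ mB', ← hπ.1, ← hπ.2,
          lintegral_map mA measurable_fst, lintegral_map mB measurable_snd]
    _ ≤ _ := by
        gcongr
        rw [← ofReal_integral_eq_lintegral_ofReal (haint.indicator hA)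
          (ae_of_all _ fun x => Set.indicator_nonneg (fun _ _ => ha0 _) _),
          ← ofReal_integral_eq_lintegral_ofReal (hbint.indicator hB)
          (ae_of_all _ fun x => Set.indicator_nonneg (fun _ _ => hb0 _) _),
          integral_indicator hA, integral_indicator hB,
          ← ENNReal.ofReal_add (setIntegral_nonneg hA fun x _ => ha0 x)
            (setIntegral_nonneg hB fun x _ => hb0 x)]
        exact ENNReal.ofReal_le_ofReal hε


set_option maxHeartbeats 2000000 in
/-- Under the hypotheses of Statement 0, if for every `t` there is a
unique optimal Kantorovich plan `σ t ∈ Π(μ t, ν t)` (i.e. a unique coupling realizing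
the Kantorovich cost), then the mapping `t ↦ σ t` is continuous in the weak topology. -/
theorem unique_optimal_plan_continuous
    {X Y T : Type*} [MetricSpace X] [CompleteSpace X] [MetricSpace Y] [CompleteSpace Y]
    [MetricSpace T] [MeasurableSpace X] [BorelSpace X] [MeasurableSpace Y] [BorelSpace Y]
    (μ : T → Measure X) (ν : T → Measure Y)
    (hμp : ∀ t, IsProbabilityMeasure (μ t)) (hνp : ∀ t, IsProbabilityMeasure (ν t))
    (hμr : ∀ t, (μ t).InnerRegular) (hνr : ∀ t, (ν t).InnerRegular)
    (hμc : WeaklyContinuousFamily μ) (hνc : WeaklyContinuousFamily ν)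
    (h : X → Y → T → ℝ)
    (hcont : Continuous fun p : X × Y × T => h p.1 p.2.1 p.2.2)
    (hnonneg : ∀ x y t, 0 ≤ h x y t)
    (a : T → X → ℝ) (b : T → Y → ℝ)
    (hameas : ∀ t, Measurable (a t)) (hbmeas : ∀ t, Measurable (b t))
    (ha0 : ∀ t x, 0 ≤ a t x) (hb0 : ∀ t y, 0 ≤ b t y)
    (haint : ∀ t, Integrable (a t) (μ t)) (hbint : ∀ t, Integrable (b t) (ν t))
    (hdom : ∀ t x y, h x y t ≤ a t x + b t y)
    (hunif : ∀ ε > (0 : ℝ), ∃ R₀ : ℝ, ∀ R ≥ R₀, ∀ t : T,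
      (∫ x in {x | R ≤ a t x}, a t x ∂(μ t)) + ∫ y in {y | R ≤ b t y}, b t y ∂(ν t) ≤ ε)
    (σ : T → Measure (X × Y))
    (hσopt : ∀ t, IsCoupling (σ t) (μ t) (ν t) ∧
      (∫⁻ p, ENNReal.ofReal (h p.1 p.2 t) ∂(σ t)) =
        kantorovichCost (fun x y => h x y t) (μ t) (ν t))
    (hσuniq : ∀ t (σ' : Measure (X × Y)), IsCoupling σ' (μ t) (ν t) →
      (∫⁻ p, ENNReal.ofReal (h p.1 p.2 t) ∂σ') =
        kantorovichCost (fun x y => h x y t) (μ t) (ν t) → σ' = σ t) :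
    WeaklyContinuousFamily σ := by
  intro f
  refine continuous_iff_seqContinuous.2 fun u t0 hu => ?_
  show Tendsto (fun n => ∫ p, f p ∂(σ (u n))) atTop (𝓝 (∫ p, f p ∂(σ t0)))
  -- index set: `none` is the limit
  let v : ℕ → T := fun n => Nat.casesOn n t0 u
  obtain ⟨S, hSc, hSs, hS⟩ := aux_support (fun n => μ (v n)) (fun n => hμp _) (fun n => hμr _)
  obtain ⟨R, hRc, hRs, hR⟩ := aux_support (fun n => ν (v n)) (fun n => hνp _) (fun n => hνr _)
  have := hSs.secondCountableTopology
  have := hRs.secondCountableTopology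
  have := hSc.completeSpace_coe
  have := hRc.completeSpace_coe
  have eS := MeasurableEmbedding.subtype_coe hSc.measurableSet
  have eR := MeasurableEmbedding.subtype_coe hRc.measurableSet
  let e : S × R → X × Y := Prod.map Subtype.val Subtype.val
  have he : MeasurableEmbedding e := eS.prodMap eR
  have hfe : Continuous e := continuous_subtype_val.prodMap continuous_subtype_val
  -- lifted measures
  have hσp : ∀ t, IsProbabilityMeasure (σ t) := fun t => 
    have := hμp t
    aux_prob (hσopt t).1
  have mS : ∀ n, ((μ (v n)).comap (Subtype.val : S → X)).map Subtype.val = μ (v n) := fun n =>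
    aux_map_comap S hSc.measurableSet _ (hS n)
  have mR : ∀ n, ((ν (v n)).comap (Subtype.val : R → Y)).map Subtype.val = ν (v n) := fun n =>
    aux_map_comap R hRc.measurableSet _ (hR n)
  have me : ∀ n, ((σ (v n)).comap e).map e = σ (v n) := by
    intro n
    rw [he.map_comap]
    refine Measure.restrict_eq_self_of_ae_mem ?_
    have hc := (hσopt (v n)).1
    have e1 : ∀ᵐ p ∂(σ (v n)), p.1 ∈ S := by
      refine ae_of_ae_map (μ := σ (v n)) (f := Prod.fst) measurable_fst.aemeasurable (p := (· ∈ S)) ?_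
      rw [hc.1, ae_iff]; exact hS n
    have e2 : ∀ᵐ p ∂(σ (v n)), p.2 ∈ R := by
      refine ae_of_ae_map (μ := σ (v n)) (f := Prod.snd) measurable_snd.aemeasurable (p := (· ∈ R)) ?_
      rw [hc.2, ae_iff]; exact hR n
    filter_upwards [e1, e2] with p h1 h2
    exact ⟨(⟨p.1, h1⟩, ⟨p.2, h2⟩), rfl⟩
  let M : ℕ → ProbabilityMeasure S := fun n => ⟨(μ (v n)).comap Subtype.val,
    have := hμp (v n)
    aux_prob_of_map _ eS.measurable _ _ (mS n)⟩
  let N : ℕ → ProbabilityMeasure R := fun n => ⟨(ν (v n)).comap Subtype.val,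
    have := hνp (v n)
    aux_prob_of_map _ eR.measurable _ _ (mR n)⟩
  let P : ℕ → ProbabilityMeasure (S × R) := fun n => ⟨(σ (v n)).comap e,
    have := hσp (v n)
    aux_prob_of_map _ he.measurable _ _ (me n)⟩
  have hM : ∀ n, (M n : Measure S).map Subtype.val = μ (v n) := mS
  have hN : ∀ n, (N n : Measure R).map Subtype.val = ν (v n) := mR
  have hP : ∀ n, (P n : Measure (S × R)).map e = σ (v n) := me
  clear_value M N P
  -- couplings
  have push : ∀ n (π : Measure (S × R)), IsCoupling π (M n) (N n) →
      IsCoupling (π.map e) (μ (v n)) (ν (v n)) := by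
    intro n π hπ
    constructor
    · rw [Measure.map_map measurable_fst he.measurable, ← hM n, ← hπ.1,
        Measure.map_map eS.measurable measurable_fst]
      rfl
    · rw [Measure.map_map measurable_snd he.measurable, ← hN n, ← hπ.2,
        Measure.map_map eR.measurable measurable_snd]
      rfl
  have hPc : ∀ n, IsCoupling (P n : Measure (S × R)) (M n) (N n) := by
    intro n
    have hc := (hσopt (v n)).1
    constructor
    · have : ((P n : Measure (S × R)).map Prod.fst).map Subtype.val
          = (M n : Measure S).map Subtype.val := by
        rw [hM n, ← hc.1, ← hP n, Measure.map_map measurable_fst he.measurable,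
          Measure.map_map eS.measurable measurable_fst]
        rfl
      have h2 := congrArg (Measure.comap (Subtype.val : S → X)) this
      rwa [eS.comap_map, eS.comap_map] at h2
    · have : ((P n : Measure (S × R)).map Prod.snd).map Subtype.val
          = (N n : Measure R).map Subtype.val := by
        rw [hN n, ← hc.2, ← hP n, Measure.map_map measurable_snd he.measurable,
          Measure.map_map eR.measurable measurable_snd]
        rfl
      have h2 := congrArg (Measure.comap (Subtype.val : R → Y)) this
      rwa [eR.comap_map, eR.comap_map] at h2
  let G : T → S × R → ℝ := fun t p => h (e p).1 (e p).2 t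
  have lint : ∀ t (π : Measure (S × R)), ∫⁻ p, ENNReal.ofReal (G t p) ∂π =
      ∫⁻ p, ENNReal.ofReal (h p.1 p.2 t) ∂(π.map e) := fun t π =>
    (he.lintegral_map (fun p : X × Y => ENNReal.ofReal (h p.1 p.2 t))).symm
  have hK : ∀ t (π : Measure (X × Y)), IsCoupling π (μ t) (ν t) →
      kantorovichCost (fun x y => h x y t) (μ t) (ν t) ≤ ∫⁻ p, ENNReal.ofReal (h p.1 p.2 t) ∂π := by
    intro t π hπ
    unfold kantorovichCost
    first
      | exact iInf₂_le π hπ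
      | exact sInf_le ⟨π, hπ, rfl⟩
  have hmain : Tendsto (fun n => P (n + 1)) atTop (𝓝 (P 0)) := by
    refine aux_main (fun n => M (n + 1)) (fun n => N (n + 1)) (M 0) (N 0) (fun n => P (n + 1)) (P 0)
      ?_ ?_ u t0 hu G ?_ (fun t p => hnonneg _ _ _) ?_ (fun n => hPc _) (hPc 0) ?_ ?_
    · exact aux_weak S hSc (fun n => μ (u n)) (μ t0) _ _ (fun n => hM (n + 1)) (hM 0)
        fun f => ((hμc f).tendsto t0).comp hu
    · exact aux_weak R hRc (fun n => ν (u n)) (ν t0) _ _ (fun n => hN (n + 1)) (hN 0)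
        fun f => ((hνc f).tendsto t0).comp hu
    · exact hcont.comp (f := fun q : T × (S × R) => ((e q.2).1, (e q.2).2, q.1)) (by fun_prop)
    · intro ε hε
      obtain ⟨R₀, hR₀⟩ := hunif ε hε
      refine ⟨2 * max R₀ 0, by positivity, fun n π hπ => ?_⟩
      have := aux_UI (μ (u n)) (ν (u n)) (fun x y => h x y (u n)) (a (u n)) (b (u n)) (hameas _)
        (hbmeas _) (ha0 _) (hb0 _) (haint _) (hbint _) (hdom _) (max R₀ 0) ε (le_max_right _ _)
        (hR₀ _ (le_max_left _ _) _) _ (push (n + 1) π hπ)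
      rwa [he.lintegral_map, he.lintegral_map] at this
    · intro n π hπ
      rw [lint, lint, hP]
      show ∫⁻ p, ENNReal.ofReal (h p.1 p.2 (u n)) ∂(σ (u n)) ≤ _
      rw [(hσopt (u n)).2]
      exact hK _ _ (push (n + 1) π hπ)
    · intro π hπ hle
      rw [lint, lint, hP] at hle
      have hc := push 0 π hπ
      have h1 : π.map e = σ t0 := by
        refine hσuniq t0 _ hc (le_antisymm ?_ (hK _ _ hc))
        rw [← (hσopt t0).2]
        exact hle
      have h2 := congrArg (Measure.comap e) (h1.trans (hP 0).symm)
      rwa [he.comap_map, he.comap_map] at h2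
  have := ProbabilityMeasure.tendsto_iff_forall_integral_tendsto.1 hmain
    (f.compContinuous ⟨e, hfe⟩)
  have hint : ∀ n, ∫ p, f.compContinuous ⟨e, hfe⟩ p ∂(P n : Measure (S × R)) = ∫ p, f p ∂(σ (v n)) := by
    intro n
    rw [← hP n, he.integral_map]
    rfl
  simp only [hint] at this
  exact this
end
end
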